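/- Let F be a cone subequation on ℝⁿ satisfying condition (F3), let Ω ⊂ ℝⁿ be a bounded domain with smooth strictly F-convex boundary, let φ ∈ C(∂Ω), and let x₀ ∈ Ω. Assume (H1): h ∈ C(Ω̄) is F-harmonic on Ω ∖ {x₀} with a downward-pointing singularity of finite type at x₀, normalized so that h(x₀) = 0, h > 0 on Ω̄ ∖ {x₀}, and sup_{∂Ω} h = 1. Let H⁰ ∈ C(Ω̄) be the solution of the standard Dirichlet problem, i.e. H⁰ is F-harmonic on Ω with H⁰ = φ on ∂Ω. Fix t ≥ 0 and assume (H2): H⁰ + t·h is F-subharmonic on Ω. Then there exists H^t ∈ C(Ω̄) such that: (1) H^t is F-harmonic on Ω ∖ {x₀}; (2) H^t = φ on ∂Ω; (3) H⁰ + t(h − 1) ≤ H^t on Ω̄ with equality at x₀, so that H^t(x₀) = H⁰(x₀) − t; and (4) there exists λ > 0 such that H^t ≤ λ·h + H⁰(x₀) + t(h − 1) on Ω̄, with equality at x₀. -/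

import Mathlib

open scoped Topology Classical
open Filter

noncomputable section

/-- Euclidean space ℝⁿ. -/
abbrev EucSp (n : ℕ) := EuclideanSpace ℝ (Fin n)

/-- The space Sym²(ℝⁿ) of symmetric real n×n matrices, with its subspace topology. -/
abbrev SymMat (n : ℕ) := selfAdjoint (Matrix (Fin n) (Fin n) ℝ)

variable {n : ℕ}

/-- The matrix of the orthogonal projection onto the line ℝ·e (for a unit vector e). -/
def projMat (e : EucSp n) : Matrix (Fin n) (Fin n) ℝ := Matrix.of fun i j => e i * e j

lemma projMat_selfAdjoint (e : EucSp n) :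
    projMat e ∈ selfAdjoint (Matrix (Fin n) (Fin n) ℝ) := by
  rw [selfAdjoint.mem_iff]
  ext i j
  simp [projMat, Matrix.star_apply, mul_comm]

/-- P_e, the projection onto ℝ·e, as an element of Sym²(ℝⁿ). -/
def symProj (e : EucSp n) : SymMat n := ⟨projMat e, projMat_selfAdjoint e⟩

/-- The matrix P_{e⊥} − (p−1)·P_e. -/
def charMatM (p : ℝ) (e : EucSp n) : Matrix (Fin n) (Fin n) ℝ :=
  (1 - projMat e) - (p - 1) • projMat e

lemma charMatM_selfAdjoint (p : ℝ) (e : EucSp n) :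
    charMatM p e ∈ selfAdjoint (Matrix (Fin n) (Fin n) ℝ) := by
  have h := projMat_selfAdjoint e
  rw [selfAdjoint.mem_iff] at h ⊢
  simp [charMatM, star_sub, star_smul, star_one, h]

/-- P_{e⊥} − (p−1)·P_e as an element of Sym²(ℝⁿ). -/
def charMat (p : ℝ) (e : EucSp n) : SymMat n := ⟨charMatM p e, charMatM_selfAdjoint p e⟩

/-- A (constant coefficient, pure second order) cone subequation on ℝⁿ: a nonempty,
closed, proper subset of Sym²(ℝⁿ) satisfying positivity (F1) and the cone property (F2). -/
structure ConeSubequation (n : ℕ) where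
  carrier : Set (SymMat n)
  nonempty' : carrier.Nonempty
  proper' : carrier ≠ Set.univ
  isClosed' : IsClosed carrier
  f1 : ∀ A ∈ carrier, ∀ P : SymMat n, (P : Matrix (Fin n) (Fin n) ℝ).PosSemidef → A + P ∈ carrier
  f2 : ∀ A ∈ carrier, ∀ t : ℝ, 0 < t → t • A ∈ carrier

/-- The dual of a set of symmetric matrices: F̃ = {A : −A ∉ Int F}. -/
def dualSet (S : Set (SymMat n)) : Set (SymMat n) := {A | -A ∉ interior S}

/-- The subequation P = {A ≥ 0} of positive semidefinite matrices. -/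
def PosP (n : ℕ) : Set (SymMat n) := {A | (A : Matrix (Fin n) (Fin n) ℝ).PosSemidef}

/-- The Hessian matrix (D²f)(x) of a real function on ℝⁿ. -/
def hessMatrix (f : EucSp n → ℝ) (x : EucSp n) : Matrix (Fin n) (Fin n) ℝ :=
  Matrix.of fun i j =>
    iteratedFDeriv ℝ 2 f x ![EuclideanSpace.single i 1, EuclideanSpace.single j 1]

/-- ψ is a test function for u at x₀ (relative to the set X): ψ is C² near x₀,
u ≤ ψ near x₀ (within X), and u(x₀) = ψ(x₀). -/
def IsTestAt (X : Set (EucSp n)) (u : EucSp n → EReal) (ψ : EucSp n → ℝ) (x₀ : EucSp n) :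
    Prop :=
  ContDiffAt ℝ 2 ψ x₀ ∧ (∀ᶠ x in 𝓝[X] x₀, u x ≤ (ψ x : EReal)) ∧ u x₀ = (ψ x₀ : EReal)

/-- u admits no test functions at x₀ (relative to X). -/
def NoTestAt (X : Set (EucSp n)) (u : EucSp n → EReal) (x₀ : EucSp n) : Prop :=
  ∀ ψ : EucSp n → ℝ, ¬ IsTestAt X u ψ x₀

/-- u is S-subharmonic on X (viscosity sense): u is upper semicontinuous on X with values
in [−∞,∞), and for every test function ψ for u at a point of X, the Hessian of ψ there
lies in S. -/
def FSubharmonicOn (S : Set (SymMat n)) (X : Set (EucSp n)) (u : EucSp n → EReal) : Prop :=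
  UpperSemicontinuousOn u X ∧ (∀ x ∈ X, u x ≠ ⊤) ∧
    ∀ x₀ ∈ X, ∀ ψ : EucSp n → ℝ, IsTestAt X u ψ x₀ →
      hessMatrix ψ x₀ ∈ Subtype.val '' S

/-- u is F-harmonic on X: u is F-subharmonic and −u is F̃-subharmonic on X. -/
def FHarmonicOn (F : ConeSubequation n) (X : Set (EucSp n)) (u : EucSp n → EReal) : Prop :=
  FSubharmonicOn F.carrier X u ∧ FSubharmonicOn (dualSet F.carrier) X (fun x => -u x)

/-- u is subaffine on X, i.e. P̃-subharmonic on X. -/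
def SubaffineOn (X : Set (EucSp n)) (u : EucSp n → EReal) : Prop :=
  FSubharmonicOn (dualSet (PosP n)) X u

/-- h is a downward-pointing singular F-harmonic at x₀ on the neighborhood U:
continuous, F-subharmonic on U, F-harmonic on U∖{x₀}, with a strict minimum at x₀, and
either of polar type (h(x₀) = −∞) or of finite type (h(x₀) > −∞, no test functions at x₀). -/
structure DPSingular (F : ConeSubequation n) (U : Set (EucSp n)) (x₀ : EucSp n)
    (h : EucSp n → EReal) : Prop where
  isOpen' : IsOpen U
  mem : x₀ ∈ U
  cont : ContinuousOn h U
  subh : FSubharmonicOn F.carrier U h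
  harm : FHarmonicOn F (U \ {x₀}) h
  strictMin : ∀ x ∈ U, x ≠ x₀ → h x₀ < h x
  polarOrFinite : h x₀ = ⊥ ∨ (h x₀ ≠ ⊥ ∧ NoTestAt U h x₀)

/-- Polar-case asymptotic equivalence H ≈ h at x₀: h − C ≤ H ≤ h + C near x₀. -/
def PolarAsymp (H : EucSp n → ℝ) (h : EucSp n → EReal) (x₀ : EucSp n) : Prop :=
  ∃ C : ℝ, ∀ᶠ x in 𝓝[≠] x₀, h x - (C : EReal) ≤ (H x : EReal) ∧ (H x : EReal) ≤ h x + (C : EReal)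

/-- Finite-case asymptotic equivalence H ∼ h at x₀:
lim_{x→x₀} (H(x) − H(x₀))/(h(x) − h(x₀)) = 1. -/
def FiniteAsymp (H : EucSp n → ℝ) (h : EucSp n → EReal) (x₀ : EucSp n) : Prop :=
  Tendsto (fun x => (H x - H x₀) / ((h x).toReal - (h x₀).toReal)) (𝓝[≠] x₀) (𝓝 1)

/-- Ω is a bounded domain: open, connected and bounded. -/
def IsBoundedDomain (Ω : Set (EucSp n)) : Prop :=
  IsOpen Ω ∧ IsConnected Ω ∧ Bornology.IsBounded Ω

/-- Condition (F3): −P_e ∉ F for every unit vector e. -/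
def CondF3 (F : ConeSubequation n) : Prop :=
  ∀ e : EucSp n, ‖e‖ = 1 → -(symProj e) ∉ F.carrier

/-- The inward unit normal −∇ρ(x)/|∇ρ(x)| of the hypersurface {ρ = 0} bounding {ρ < 0}. -/
def innerNormal (ρ : EucSp n → ℝ) (x : EucSp n) : EucSp n :=
  -(‖gradient ρ x‖⁻¹ • gradient ρ x)

/-- The second fundamental form of {ρ = 0} at x with respect to the inward normal,
extended by zero on the normal line: the tangential part of Hess ρ(x)/|∇ρ(x)|. -/
def secondFF (ρ : EucSp n → ℝ) (x : EucSp n) : Matrix (Fin n) (Fin n) ℝ :=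
  ‖gradient ρ x‖⁻¹ •
    ((1 - projMat (innerNormal ρ x)) * hessMatrix ρ x * (1 - projMat (innerNormal ρ x)))

/-- Ω has smooth boundary which is strictly F-convex: Ω is globally defined by a smooth
defining function ρ with nonvanishing gradient along ∂Ω, and at every boundary point
II_x + t·P_{ν(x)} ∈ Int F for all sufficiently large t. -/
def StrictlyConvexBoundary (F : ConeSubequation n) (Ω : Set (EucSp n)) : Prop :=
  ∃ ρ : EucSp n → ℝ, ContDiff ℝ (⊤ : ℕ∞) ρ ∧ Ω = {x | ρ x < 0} ∧
    ∀ x ∈ frontier Ω, gradient ρ x ≠ 0 ∧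
      ∃ t₀ : ℝ, ∀ t ≥ t₀,
        secondFF ρ x + t • projMat (innerNormal ρ x) ∈ Subtype.val '' interior F.carrier

/-- F is invariant under O(n): gᵀ A g ∈ F for every orthogonal g and A ∈ F. -/
def OrthInvariant (F : ConeSubequation n) : Prop :=
  ∀ g : Matrix (Fin n) (Fin n) ℝ, g.transpose * g = 1 →
    ∀ A ∈ F.carrier, ∀ B : SymMat n,
      (B : Matrix (Fin n) (Fin n) ℝ) = g.transpose * (A : Matrix (Fin n) (Fin n) ℝ) * g →
      B ∈ F.carrier

/-- F has Riesz characteristic p: P_{e⊥} − (p−1)P_e ∈ ∂F for every unit vector e. -/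
def HasRieszChar (F : ConeSubequation n) (p : ℝ) : Prop :=
  ∀ e : EucSp n, ‖e‖ = 1 → charMat p e ∈ frontier F.carrier

/-- The Riesz kernel K_p. -/
def rieszKernel (p : ℝ) (x : EucSp n) : ℝ :=
  if p = 2 then Real.log ‖x‖ else -(p - 2)⁻¹ * ‖x‖ ^ (2 - p)

/-- The linear endomorphism of ℝⁿ given by a symmetric matrix. -/
def symMap (A : SymMat n) : EucSp n →L[ℝ] EucSp n :=
  Matrix.toEuclideanCLM (n := Fin n) (𝕜 := ℝ) (A : Matrix (Fin n) (Fin n) ℝ)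

/-- The bilinear form of a symmetric matrix. -/
def symForm (A : SymMat n) (x y : EucSp n) : ℝ := inner ℝ x (symMap A y)

lemma symMap_add (A B : SymMat n) : symMap (A + B) = symMap A + symMap B := by
  simp [symMap]

lemma symMap_neg (A : SymMat n) : symMap (-A) = -symMap A := by
  simp [symMap]

lemma symMap_smul (c : ℝ) (A : SymMat n) : symMap (c • A) = c • symMap A := by
  simp [symMap]

lemma symMap_one : symMap (1 : SymMat n) = 1 := by
  simp [symMap]

lemma symForm_add (A B : SymMat n) (x y : EucSp n) :
    symForm (A + B) x y = symForm A x y + symForm B x y := by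
  simp [symForm, symMap_add, inner_add_right]

lemma symForm_neg (A : SymMat n) (x y : EucSp n) : symForm (-A) x y = -symForm A x y := by
  simp [symForm, symMap_neg]

lemma symForm_sub (A B : SymMat n) (x y : EucSp n) :
    symForm (A - B) x y = symForm A x y - symForm B x y := by
  rw [sub_eq_add_neg, symForm_add, symForm_neg, sub_eq_add_neg]

lemma symForm_smul (c : ℝ) (A : SymMat n) (x y : EucSp n) :
    symForm (c • A) x y = c * symForm A x y := by
  simp [symForm, symMap_smul, inner_smul_right]

lemma symForm_one (x y : EucSp n) : symForm (1 : SymMat n) x y = inner ℝ x y := by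
  simp [symForm, symMap_one]

lemma symForm_eq_sum (A : SymMat n) (x y : EucSp n) :
    symForm A x y = ∑ i, ∑ j, x i * (A : Matrix (Fin n) (Fin n) ℝ) i j * y j := by
  simp [symForm, symMap, Matrix.inner_toEuclideanCLM, dotProduct, Matrix.mulVec, Finset.mul_sum,
    mul_assoc]

lemma SymMat.apply_comm (A : SymMat n) (i j : Fin n) :
    (A : Matrix (Fin n) (Fin n) ℝ) i j = (A : Matrix (Fin n) (Fin n) ℝ) j i := by
  have h := selfAdjoint.mem_iff.1 A.2
  have h' : (star (A : Matrix (Fin n) (Fin n) ℝ)) i j = (A : Matrix (Fin n) (Fin n) ℝ) i j := by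
    rw [h]
  simpa [Matrix.star_apply] using h'.symm

lemma symForm_comm (A : SymMat n) (x y : EucSp n) : symForm A x y = symForm A y x := by
  rw [symForm_eq_sum, symForm_eq_sum, Finset.sum_comm]
  refine Finset.sum_congr rfl fun i _ => Finset.sum_congr rfl fun j _ => ?_
  rw [SymMat.apply_comm A j i]; ring

lemma symForm_single (A : SymMat n) (i j : Fin n) :
    symForm A (EuclideanSpace.single i 1) (EuclideanSpace.single j 1) =
      (A : Matrix (Fin n) (Fin n) ℝ) i j := by
  simp [symForm_eq_sum]

lemma symForm_add_left (A : SymMat n) (x y z : EucSp n) :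
    symForm A (x + y) z = symForm A x z + symForm A y z := by
  simp [symForm, inner_add_left]

lemma symForm_add_right (A : SymMat n) (x y z : EucSp n) :
    symForm A x (y + z) = symForm A x y + symForm A x z := by
  simp [symForm, inner_add_right]

lemma symForm_sub_left (A : SymMat n) (x y z : EucSp n) :
    symForm A (x - y) z = symForm A x z - symForm A y z := by
  simp [symForm, inner_sub_left]

lemma symForm_sub_right (A : SymMat n) (x y z : EucSp n) :
    symForm A x (y - z) = symForm A x y - symForm A x z := by
  simp [symForm, inner_sub_right]

lemma symForm_smul_left (A : SymMat n) (c : ℝ) (x y : EucSp n) :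
    symForm A (c • x) y = c * symForm A x y := by
  simp [symForm, inner_smul_left]

lemma symForm_smul_right (A : SymMat n) (c : ℝ) (x y : EucSp n) :
    symForm A x (c • y) = c * symForm A x y := by
  simp [symForm, inner_smul_right]

lemma posSemidef_of_symForm_nonneg (A : SymMat n) (h : ∀ x, 0 ≤ symForm A x x) :
    (A : Matrix (Fin n) (Fin n) ℝ).PosSemidef := by
  rw [Matrix.posSemidef_iff_dotProduct_mulVec]
  refine ⟨by have := selfAdjoint.mem_iff.1 A.2; rwa [Matrix.star_eq_conjTranspose] at this,
    fun x => ?_⟩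
  have := h (WithLp.toLp 2 x)
  rw [symForm, symMap, Matrix.inner_toEuclideanCLM] at this
  simpa using this

/-- Every symmetric continuous bilinear form is the form of a symmetric matrix. -/
lemma exists_symForm_eq (B : EucSp n →L[ℝ] EucSp n →L[ℝ] ℝ) (hB : ∀ x y, B x y = B y x) :
    ∃ A : SymMat n, ∀ x y, symForm A x y = B x y := by
  refine ⟨⟨Matrix.of fun i j => B (EuclideanSpace.single i 1) (EuclideanSpace.single j 1), ?_⟩,
    fun x y => ?_⟩
  · rw [selfAdjoint.mem_iff]
    ext i j
    simp [Matrix.star_apply, hB (EuclideanSpace.single i 1)]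
  · rw [symForm_eq_sum]
    have hx : ∀ x : EucSp n, x = ∑ i, x i • EuclideanSpace.single i (1 : ℝ) := fun x => by
      ext j; simp [Pi.single_apply]
    conv_rhs => rw [hx x, hx y]
    simp only [map_sum, map_smul, sum_apply, smul_apply,
      smul_eq_mul, Finset.mul_sum, Matrix.of_apply]
    refine (Finset.sum_comm.trans ?_)
    refine Finset.sum_congr rfl fun i _ => Finset.sum_congr rfl fun j _ => ?_
    ring

lemma abs_symForm_le (A : SymMat n) (x y : EucSp n) :
    |symForm A x y| ≤ ‖symMap A‖ * ‖x‖ * ‖y‖ := by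
  refine (abs_real_inner_le_norm _ _).trans ?_
  have := (symMap A).le_opNorm y
  nlinarith [norm_nonneg x]

/-- Closed sets of symmetric matrices which are stable under adding positive matrices. -/
structure IsSubeq (S : Set (SymMat n)) : Prop where
  closed : IsClosed S
  mono : ∀ A ∈ S, ∀ B : SymMat n, (∀ x, symForm A x x ≤ symForm B x x) → B ∈ S

lemma ConeSubequation.isSubeq (F : ConeSubequation n) : IsSubeq F.carrier where
  closed := F.isClosed'
  mono A hA B h := by
    have := F.f1 A hA (B - A) (posSemidef_of_symForm_nonneg _ fun x => by
      rw [symForm_sub]; linarith [h x])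
    simpa using this

lemma continuous_add_smul_one (A : SymMat n) :
    Continuous fun η : ℝ => A + η • (1 : SymMat n) := by
  refine continuous_induced_rng.2 ?_
  change Continuous fun η : ℝ => (A : Matrix (Fin n) (Fin n) ℝ) + η • (1 : Matrix (Fin n) (Fin n) ℝ)
  fun_prop

lemma IsSubeq.exists_sub_mem {S : Set (SymMat n)} {A : SymMat n}
    (hA : A ∈ interior S) : ∃ η > (0 : ℝ), A - η • (1 : SymMat n) ∈ S := by
  have hc : Tendsto (fun η : ℝ => A - η • (1 : SymMat n)) (𝓝[>] 0) (𝓝 A) := by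
    have := ((continuous_add_smul_one A).comp continuous_neg).tendsto 0
    simp only [Function.comp_def, neg_smul, ← sub_eq_add_neg, zero_smul, sub_zero] at this
    exact this.mono_left nhdsWithin_le_nhds
  have h1 := hc (mem_interior_iff_mem_nhds.1 hA)
  obtain ⟨η, h, h'⟩ := ((mem_map.1 h1 : _) |> fun h => (Filter.Eventually.and h
    self_mem_nhdsWithin : ∀ᶠ η in 𝓝[>] (0 : ℝ), _ ∧ _)).exists
  exact ⟨η, h', h⟩

lemma continuous_symMap : Continuous (symMap : SymMat n → EucSp n →L[ℝ] EucSp n) := by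
  have h : Continuous fun M : Matrix (Fin n) (Fin n) ℝ =>
      (Matrix.toEuclideanCLM (n := Fin n) (𝕜 := ℝ) M) :=
    LinearMap.continuous_of_finiteDimensional
      (Matrix.toEuclideanCLM (n := Fin n) (𝕜 := ℝ)).toAlgEquiv.toLinearMap
  exact h.comp continuous_subtype_val

lemma IsSubeq.mem_interior {S : Set (SymMat n)} (hS : IsSubeq S) {A B : SymMat n} {η : ℝ}
    (hη : 0 < η) (hA : A ∈ S) (h : ∀ x, symForm A x x + η * ‖x‖ ^ 2 ≤ symForm B x x) :
    B ∈ interior S := by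
  rw [mem_interior_iff_mem_nhds]
  have h1 : ∀ᶠ C in 𝓝 B, dist (symMap C) (symMap B) < η :=
    continuous_symMap.continuousAt.eventually (Metric.ball_mem_nhds _ hη)
  filter_upwards [h1] with C hC
  refine hS.mono A hA C fun x => ?_
  have h2 : |inner ℝ x ((symMap C - symMap B) x)| ≤ η * ‖x‖ ^ 2 := by
    refine (abs_real_inner_le_norm _ _).trans ?_
    have h3 := (symMap C - symMap B).le_opNorm x
    rw [dist_eq_norm] at hC
    have h4 : ‖(symMap C - symMap B) x‖ ≤ η * ‖x‖ :=
      h3.trans (mul_le_mul_of_nonneg_right hC.le (norm_nonneg _))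
    nlinarith [norm_nonneg x]
  have h5 : inner ℝ x ((symMap C - symMap B) x) = symForm C x x - symForm B x x := by
    simp [symForm, inner_sub_right]
  rw [h5] at h2
  linarith [h x, (abs_le.1 h2).1]

lemma IsSubeq.mem_of_forall_add {S : Set (SymMat n)} (hS : IsSubeq S) {A : SymMat n}
    {c : ℝ} (hc : 0 < c) (h : ∀ η : ℝ, 0 < η → η < c → A + η • (1 : SymMat n) ∈ S) : A ∈ S := by
  have ht := (continuous_add_smul_one A).tendsto 0
  simp only [zero_smul, add_zero] at ht
  refine hS.closed.mem_of_tendsto (ht.mono_left (nhdsWithin_le_nhds (s := Set.Ioi 0))) ?_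
  filter_upwards [Ioo_mem_nhdsGT hc] with η hη using h η hη.1 hη.2

lemma IsSubeq.dual {S : Set (SymMat n)} (hS : IsSubeq S) : IsSubeq (dualSet S) where
  closed := by
    have : dualSet S = ((fun A : SymMat n => -A) ⁻¹' interior S)ᶜ := rfl
    rw [this]
    exact (isOpen_interior.preimage continuous_neg).isClosed_compl
  mono A hA B h := by
    intro hB
    apply hA
    obtain ⟨η, hη, hm⟩ := IsSubeq.exists_sub_mem hB
    refine hS.mem_interior hη hm fun x => ?_
    rw [symForm_sub, symForm_smul, symForm_one, symForm_neg, symForm_neg,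
      real_inner_self_eq_norm_sq]
    linarith [h x]

lemma dualSet_smul_mem {S : Set (SymMat n)} (hS : ∀ A ∈ S, ∀ t : ℝ, 0 < t → t • A ∈ S)
    {A : SymMat n} (hA : A ∈ dualSet S) {t : ℝ} (ht : 0 < t) : t • A ∈ dualSet S := by
  intro h
  apply hA
  rw [mem_interior_iff_mem_nhds] at h ⊢
  have hc : Continuous fun B : SymMat n => t • B := by
    refine continuous_induced_rng.2 ?_
    change Continuous fun B : SymMat n => t • (B : Matrix (Fin n) (Fin n) ℝ)
    exact continuous_subtype_val.const_smul t
  have h1 : Tendsto (fun B : SymMat n => t • B) (𝓝 (-A)) (𝓝 (-(t • A))) := by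
    simpa using hc.tendsto (-A)
  filter_upwards [h1 h] with B hB
  have := hS _ hB t⁻¹ (inv_pos.2 ht)
  rwa [smul_smul, inv_mul_cancel₀ ht.ne', one_smul] at this

/-- The quadratic polynomial `z ↦ ⟨a, z⟩ + ½⟨z, A z⟩`. -/
def quadFn (a : EucSp n) (A : SymMat n) (z : EucSp n) : ℝ :=
  inner ℝ a z + (1 / 2) * symForm A z z

lemma quadFn_expand (a : EucSp n) (A : SymMat n) (x z : EucSp n) :
    quadFn a A z = quadFn a A x + inner ℝ (a + symMap A x) (z - x) +
      (1 / 2) * symForm A (z - x) (z - x) := by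
  have h1 : inner ℝ (symMap A x) (z - x) = symForm A (z - x) x := by
    rw [symForm, real_inner_comm]
  rw [inner_add_left, h1, symForm_sub_left, symForm_sub_left, symForm_sub_right,
    symForm_sub_right, inner_sub_right, symForm_comm A x z, quadFn, quadFn]
  ring

lemma quadFn_add (a b : EucSp n) (A B : SymMat n) (z : EucSp n) :
    quadFn (a + b) (A + B) z = quadFn a A z + quadFn b B z := by
  simp only [quadFn, inner_add_left, symForm_add]; ring

lemma quadFn_neg (a : EucSp n) (A : SymMat n) (z : EucSp n) :
    quadFn (-a) (-A) z = -quadFn a A z := by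
  simp only [quadFn, inner_neg_left, symForm_neg]; ring

lemma quadFn_smul (c : ℝ) (a : EucSp n) (A : SymMat n) (z : EucSp n) :
    quadFn (c • a) (c • A) z = c * quadFn a A z := by
  simp only [quadFn, real_inner_smul_left, symForm_smul]; ring

/-- Quadratic polynomials with prescribed first and second order part at a point. -/
lemma quadFn_centered (b : EucSp n) (A : SymMat n) (x z : EucSp n) :
    quadFn (b - symMap A x) A z = quadFn (b - symMap A x) A x + inner ℝ b (z - x) +
      (1 / 2) * symForm A (z - x) (z - x) := by
  rw [quadFn_expand _ A x z, sub_add_cancel]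

lemma hasFDerivAt_quadFn (a : EucSp n) (A : SymMat n) (c : ℝ) (z : EucSp n) :
    HasFDerivAt (fun z => quadFn a A z + c)
      ((innerSL ℝ (E := EucSp n)) a + (innerSL ℝ (E := EucSp n)) (symMap A z)) z := by
  have h1 : HasFDerivAt (fun z : EucSp n => inner ℝ a z) ((innerSL ℝ (E := EucSp n)) a) z :=
    ((innerSL ℝ (E := EucSp n)) a).hasFDerivAt
  have h2 := (hasFDerivAt_id z).inner ℝ ((symMap A).hasFDerivAt (x := z))
  have h3 := (h1.add (h2.const_mul (1 / 2))).add_const c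
  refine h3.congr_fderiv ?_
  ext w
  have h4 : (inner ℝ w (symMap A z) : ℝ) = inner ℝ z (symMap A w) := symForm_comm A w z
  simp [h4, real_inner_comm w (symMap A z)]
  ring

lemma contDiff_quadFn (a : EucSp n) (A : SymMat n) (c : ℝ) :
    ContDiff ℝ 2 (fun z => quadFn a A z + c) := by
  unfold quadFn symForm
  exact ((contDiff_const.inner ℝ contDiff_id).add
    (contDiff_const.mul (contDiff_id.inner ℝ (symMap A).contDiff))).add contDiff_const

lemma continuous_quadFn (a : EucSp n) (A : SymMat n) : Continuous (quadFn a A) := by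
  simpa using (contDiff_quadFn a A 0).continuous

lemma hessMatrix_quadFn (a : EucSp n) (A : SymMat n) (c : ℝ) (x : EucSp n) :
    hessMatrix (fun z => quadFn a A z + c) x = A := by
  ext i j
  rw [← symForm_single, hessMatrix, Matrix.of_apply, iteratedFDeriv_two_apply]
  have h : fderiv ℝ (fun z => quadFn a A z + c) =
      fun z => (innerSL ℝ (E := EucSp n)) a + ((innerSL ℝ (E := EucSp n)).comp (symMap A)) z := by
    ext1 z
    exact (hasFDerivAt_quadFn a A c z).fderiv
  rw [h, fderiv_const_add, ContinuousLinearMap.fderiv]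
  simp only [Matrix.cons_val_zero, Matrix.cons_val_one, ContinuousLinearMap.comp_apply,
    innerSL_apply_apply]
  rw [real_inner_comm, ← symForm, symForm_comm]

/-- Second order Taylor expansion. -/
lemma taylor_two_of_contDiffAt {ψ : EucSp n → ℝ} {x : EucSp n} (hψ : ContDiffAt ℝ 2 ψ x) :
    ∃ A : SymMat n, (A : Matrix (Fin n) (Fin n) ℝ) = hessMatrix ψ x ∧
      ∀ η > (0 : ℝ), ∀ᶠ z in 𝓝 x, |ψ z - (ψ x + inner ℝ (gradient ψ x) (z - x) +
        (1 / 2) * symForm A (z - x) (z - x))| ≤ η * ‖z - x‖ ^ 2 := by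
  have hsymm : IsSymmSndFDerivAt ℝ ψ x := hψ.isSymmSndFDerivAt (by simp)
  obtain ⟨A, hA⟩ := exists_symForm_eq (fderiv ℝ (fderiv ℝ ψ) x) (fun v w => hsymm.eq v w)
  refine ⟨A, ?_, ?_⟩
  · ext i j
    rw [← symForm_single, hA, hessMatrix, Matrix.of_apply, iteratedFDeriv_two_apply]
    simp
  · intro η hη
    have hd : DifferentiableAt ℝ (fderiv ℝ ψ) x :=
      (hψ.fderiv_right (m := 1) (by norm_num)).differentiableAt (by norm_num)
    have hlo := hd.hasFDerivAt.isLittleO.def hη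
    have hdiff : ∀ᶠ z in 𝓝 x, DifferentiableAt ℝ ψ z := by
      filter_upwards [hψ.eventually (by simp)] with z hz using hz.differentiableAt (by norm_num)
    obtain ⟨r, hr, hball⟩ := Metric.eventually_nhds_iff_ball.1 (hlo.and hdiff)
    filter_upwards [Metric.ball_mem_nhds x hr] with z hz
    set g : EucSp n → ℝ := fun y => ψ y - (ψ x + inner ℝ (gradient ψ x) (y - x) +
        (1 / 2) * symForm A (y - x) (y - x)) with hg
    have hgrad : ∀ v, inner ℝ (gradient ψ x) v = fderiv ℝ ψ x v := fun v => by
      simp [gradient]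
    have hg' : ∀ y ∈ Metric.ball x r, HasFDerivAt g
        (fderiv ℝ ψ y - fderiv ℝ ψ x - fderiv ℝ (fderiv ℝ ψ) x (y - x)) y := by
      intro y hy
      have h1 := (hball y hy).2.hasFDerivAt
      have h2 := hasFDerivAt_quadFn (gradient ψ x - symMap A x) A
        (ψ x - quadFn (gradient ψ x - symMap A x) A x) y
      refine ((h1.sub h2).congr_of_eventuallyEq (Eventually.of_forall fun w => ?_)).congr_fderiv ?_
      · simp only [hg, Pi.sub_apply]
        rw [quadFn_centered (gradient ψ x) A x w]; ring
      · ext w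
        have h3 : (inner ℝ (symMap A y) w : ℝ) = symForm A y w := by
          rw [symForm_comm, symForm, real_inner_comm]
        have h4 : (inner ℝ (symMap A x) w : ℝ) = symForm A x w := by
          rw [symForm_comm, symForm, real_inner_comm]
        simp only [sub_apply, add_apply, innerSL_apply_apply, h3, h4, hgrad, hA,
          map_sub]
        ring
    have hsub : Metric.closedBall x ‖z - x‖ ⊆ Metric.ball x r :=
      Metric.closedBall_subset_ball (by simpa [dist_eq_norm] using hz)
    have key := (convex_closedBall x ‖z - x‖).norm_image_sub_le_of_norm_hasFDerivWithin_le
      (f := g) (C := η * ‖z - x‖)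
      (fun y hy => (hg' y (hsub hy)).hasFDerivWithinAt) (fun y hy => ?_)
      (Metric.mem_closedBall_self (norm_nonneg _)) (y := z) (by simp [dist_eq_norm])
    · have h0 : g x = 0 := by simp [hg, symForm]
      rw [h0, sub_zero, Real.norm_eq_abs] at key
      calc |g z| ≤ η * ‖z - x‖ * ‖z - x‖ := key
        _ = η * ‖z - x‖ ^ 2 := by ring
    · refine ((hball y (hsub hy)).1).trans ?_
      have : ‖y - x‖ ≤ ‖z - x‖ := by simpa [dist_eq_norm] using hy
      exact mul_le_mul_of_nonneg_left this hη.le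

/-- Subharmonicity tested with quadratic polynomials only. -/
def QuadSub (S : Set (SymMat n)) (X : Set (EucSp n)) (u : EucSp n → ℝ) : Prop :=
  ∀ x ∈ X, ∀ a A, IsLocalMax (fun z => u z - quadFn a A z) x → A ∈ S

lemma FSubharmonicOn.quadSub {S : Set (SymMat n)} {X : Set (EucSp n)}
    {u : EucSp n → ℝ} (h : FSubharmonicOn S X (fun y => (u y : EReal))) : QuadSub S X u := by
  intro x hx a A hmax
  have := h.2.2 x hx (fun z => quadFn a A z + (u x - quadFn a A x))
    ⟨(contDiff_quadFn a A _).contDiffAt, ?_, ?_⟩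
  · rw [hessMatrix_quadFn] at this
    obtain ⟨B, hB, hBA⟩ := this
    rwa [← Subtype.ext hBA]
  · filter_upwards [nhdsWithin_le_nhds hmax] with z hz
    have hz' : u z - quadFn a A z ≤ u x - quadFn a A x := hz
    exact_mod_cast (by linarith : u z ≤ quadFn a A z + (u x - quadFn a A x))
  · simp

/-- Adding a small multiple of `‖z - x‖²` to a quadratic polynomial. -/
lemma quadFn_add_sq (a : EucSp n) (A : SymMat n) (η : ℝ) (x z : EucSp n) :
    quadFn (a - (2 * η) • x) (A + (2 * η) • 1) z + η * ‖x‖ ^ 2 =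
      quadFn a A z + η * ‖z - x‖ ^ 2 := by
  have h : ‖z - x‖ ^ 2 = ‖z‖ ^ 2 - 2 * inner ℝ x z + ‖x‖ ^ 2 := by
    rw [norm_sub_sq_real, real_inner_comm]
  rw [h]
  simp only [quadFn, inner_sub_left, symForm_add, symForm_smul, symForm_one,
    real_inner_smul_left, real_inner_self_eq_norm_sq]
  ring

lemma QuadSub.fSubharmonicOn {S : Set (SymMat n)} (hS : IsSubeq S) {X : Set (EucSp n)}
    (hX : IsOpen X) {u : EucSp n → ℝ} (h : QuadSub S X u) (hu : ContinuousOn u X) :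
    FSubharmonicOn S X (fun y => (u y : EReal)) := by
  refine ⟨(continuous_coe_real_ereal.comp_continuousOn hu).upperSemicontinuousOn,
    fun x _ => EReal.coe_ne_top _, fun x hx ψ hψ => ?_⟩
  obtain ⟨hC, hle, heq⟩ := hψ
  obtain ⟨A, hA, hT⟩ := taylor_two_of_contDiffAt hC
  refine ⟨A, hS.mem_of_forall_add one_pos fun η hη _ => ?_, hA⟩
  rw [hX.nhdsWithin_eq hx] at hle
  have heq' : u x = ψ x := EReal.coe_injective heq
  set b := gradient ψ x - symMap A x
  have := h x hx (b - (2 * (η / 2)) • x) (A + (2 * (η / 2)) • 1) ?_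
  · rwa [mul_div_cancel₀ _ (two_ne_zero)] at this
  · filter_upwards [hle, hT (η / 2) (by positivity)] with z hz hTz
    have hz' : u z ≤ ψ z := by exact_mod_cast hz
    have e1 := quadFn_add_sq b A (η / 2) x z
    have e2 := quadFn_add_sq b A (η / 2) x x
    have e3 := quadFn_centered (gradient ψ x) A x z
    simp only [sub_self, norm_zero] at e2
    have e4 := (abs_le.1 hTz).2
    linarith

/-- Two-sided quadratic bounds along `s`: the function is `C^{1,1}` along `s` with gradient `a`. -/
def QuadPinched (C : ℝ) (g : EucSp n → ℝ) (a : EucSp n → EucSp n) (s : Set (EucSp n)) : Prop :=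
  ∀ x ∈ s, ∀ z, |g z - g x - inner ℝ (a x) (z - x)| ≤ C * ‖z - x‖ ^ 2

lemma QuadPinched.gradient_sub_le {C : ℝ} {g : EucSp n → ℝ} {a : EucSp n → EucSp n}
    {s : Set (EucSp n)} (hC : 0 ≤ C) (h : QuadPinched C g a s) {x y : EucSp n} (hx : x ∈ s)
    (hy : y ∈ s) : ‖a x - a y‖ ≤ 6 * C * ‖x - y‖ := by
  rcases eq_or_ne x y with rfl | hxy
  · simp
  rcases eq_or_ne (a x - a y) 0 with hd | hd
  · rw [hd, norm_zero]; positivity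
  set d := a x - a y with hd_def
  set L := ‖x - y‖ with hL
  have hLpos : 0 < L := norm_pos_iff.2 (sub_ne_zero.2 hxy)
  have hdpos : 0 < ‖d‖ := norm_pos_iff.2 hd
  set v := (L / ‖d‖) • d with hv
  have hvn : ‖v‖ = L := by
    rw [hv, norm_smul, Real.norm_of_nonneg (by positivity), div_mul_cancel₀ _ hdpos.ne']
  have hin : inner ℝ d v = L * ‖d‖ := by
    rw [hv, inner_smul_right, real_inner_self_eq_norm_sq]; field_simp
  have h1 := h y hy (y + v)
  have h2 := h x hx (y + v)
  have h3 := h x hx y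
  rw [add_sub_cancel_left, hvn] at h1
  have h4 : ‖y + v - x‖ ≤ 2 * L := by
    have : y + v - x = v - (x - y) := by abel
    rw [this]
    linarith [norm_sub_le v (x - y)]
  have h5 : C * ‖y + v - x‖ ^ 2 ≤ C * (4 * L ^ 2) := by
    refine mul_le_mul_of_nonneg_left ?_ hC
    nlinarith [norm_nonneg (y + v - x)]
  rw [norm_sub_rev y x, ← hL] at h3
  have h6 : (inner ℝ (a x) (y + v - x) : ℝ) = inner ℝ (a x) (y - x) + inner ℝ (a x) v := by
    rw [← inner_add_right]; congr 1; abel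
  have h7 : (inner ℝ d v : ℝ) = inner ℝ (a x) v - inner ℝ (a y) v := by
    rw [hd_def, inner_sub_left]
  have key : L * ‖d‖ ≤ L * (6 * C * L) := by
    rw [abs_le] at h1 h2 h3
    nlinarith
  exact le_of_mul_le_mul_left key hLpos

lemma QuadPinched.step {C : ℝ} {g : EucSp n → ℝ} {a : EucSp n → EucSp n}
    {s : Set (EucSp n)} (hC : 0 ≤ C) (h : QuadPinched C g a s) {x w z' : EucSp n}
    (D : EucSp n →L[ℝ] EucSp n) (k : ℕ) (hz' : z' ∈ s) (h1 : ‖x + (k : ℝ) • w - z'‖ ≤ ‖w‖)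
    (h2 : ‖a z' - a x - D (z' - x)‖ ≤ 2 * ‖w‖) :
    |g (x + ((k + 1 : ℕ) : ℝ) • w) - g (x + (k : ℝ) • w) - inner ℝ (a x) w
      - k * inner ℝ (D w) w| ≤ (2 + ‖D‖ + 5 * C) * ‖w‖ ^ 2 := by
  set y := x + (k : ℝ) • w with hy
  have hy1 : x + ((k + 1 : ℕ) : ℝ) • w = y + w := by
    rw [hy]; push_cast; rw [add_smul, one_smul]; abel
  rw [hy1]
  have e1 := h z' hz' (y + w)
  have e2 := h z' hz' y
  have n1 : ‖y + w - z'‖ ≤ 2 * ‖w‖ := by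
    have : y + w - z' = (y - z') + w := by abel
    rw [this]; linarith [norm_add_le (y - z') w]
  have e1' : C * ‖y + w - z'‖ ^ 2 ≤ C * (4 * ‖w‖ ^ 2) :=
    mul_le_mul_of_nonneg_left (by nlinarith [norm_nonneg (y + w - z')]) hC
  have e2' : C * ‖y - z'‖ ^ 2 ≤ C * ‖w‖ ^ 2 :=
    mul_le_mul_of_nonneg_left (by nlinarith [norm_nonneg (y - z')]) hC
  have e3 : (inner ℝ (a z') (y + w - z') : ℝ) = inner ℝ (a z') (y - z') + inner ℝ (a z') w := by
    rw [← inner_add_right]; congr 1; abel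
  have e4 : a z' = a x + (k : ℝ) • D w + ((a z' - a x - D (z' - x)) + D (z' - y)) := by
    rw [map_sub, map_sub, hy, map_add, map_smul]; abel
  have e5 : (inner ℝ (a z') w : ℝ) = inner ℝ (a x) w + k * inner ℝ (D w) w +
      inner ℝ ((a z' - a x - D (z' - x)) + D (z' - y)) w := by
    conv_lhs => rw [e4]
    rw [inner_add_left, inner_add_left, real_inner_smul_left]
  have e6 : |inner ℝ ((a z' - a x - D (z' - x)) + D (z' - y)) w| ≤ (2 + ‖D‖) * ‖w‖ ^ 2 := by
    refine (abs_real_inner_le_norm _ _).trans ?_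
    have f1 := norm_add_le (a z' - a x - D (z' - x)) (D (z' - y))
    have f2 := D.le_opNorm (z' - y)
    rw [norm_sub_rev z' y] at f2
    have f3 : ‖D‖ * ‖y - z'‖ ≤ ‖D‖ * ‖w‖ := mul_le_mul_of_nonneg_left h1 (norm_nonneg _)
    nlinarith [norm_nonneg w]
  rw [abs_le] at *
  constructor <;> linarith [e1.1, e1.2, e2.1, e2.2, e6.1, e6.2]

/-- Second order expansion of a pinched function at points where its gradient is differentiable
along `s` and `s` is dense enough. -/
lemma QuadPinched.expansion {C : ℝ} {g : EucSp n → ℝ} {a : EucSp n → EucSp n}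
    {s : Set (EucSp n)} (hC : 0 ≤ C) (h : QuadPinched C g a s) {x : EucSp n} (hx : x ∈ s)
    {D : EucSp n →L[ℝ] EucSp n} (hD : HasFDerivWithinAt a D s x)
    (hs : ∀ ε > (0 : ℝ), ∀ᶠ z in 𝓝 x, Metric.infDist z s ≤ ε * ‖z - x‖) {η : ℝ} (hη : 0 < η) :
    ∀ᶠ z in 𝓝 x, |g z - g x - inner ℝ (a x) (z - x) - (1 / 2) * inner ℝ (D (z - x)) (z - x)|
      ≤ η * ‖z - x‖ ^ 2 := by
  set K := 2 + ‖D‖ + 5 * C with hK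
  obtain ⟨N, hN⟩ := exists_nat_gt (max 1 ((K + ‖D‖) / η))
  have hN1 : (1 : ℝ) < N := (le_max_left _ _).trans_lt hN
  have hN0 : (0 : ℝ) < N := one_pos.trans hN1
  have hNη : K + ‖D‖ ≤ η * N := by
    have := (le_max_right 1 ((K + ‖D‖) / η)).trans hN.le
    rwa [div_le_iff₀ hη, mul_comm] at this
  have hd := hD.isLittleO.def (c := 1 / N) (by positivity)
  rw [eventually_nhdsWithin_iff] at hd
  obtain ⟨r, hr, hball⟩ := Metric.eventually_nhds_iff_ball.1
    (hd.and (hs (1 / (2 * N)) (by positivity)))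
  filter_upwards [Metric.ball_mem_nhds x (half_pos hr)] with z hz
  rcases eq_or_ne z x with rfl | hzx
  · simp
  have hLpos : 0 < ‖z - x‖ := norm_pos_iff.2 (sub_ne_zero.2 hzx)
  set w := (1 / (N : ℝ)) • (z - x) with hw
  have hzw : z - x = (N : ℝ) • w := by
    rw [hw, smul_smul, mul_one_div_cancel hN0.ne', one_smul]
  have hwL : ‖z - x‖ = N * ‖w‖ := by
    rw [hzw, norm_smul, Real.norm_of_nonneg hN0.le]
  have hwpos : 0 < ‖w‖ := by
    rw [hwL] at hLpos; exact pos_of_mul_pos_right hLpos hN0.le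
  have hzr : N * ‖w‖ < r / 2 := by
    rw [← hwL]; simpa [dist_eq_norm] using hz
  have hind : ∀ k : ℕ, k ≤ N → |g (x + (k : ℝ) • w) - g x - k * inner ℝ (a x) w
      - (k * (k - 1) / 2) * inner ℝ (D w) w| ≤ k * (K * ‖w‖ ^ 2) := by
    intro k
    induction k with
    | zero => intro _; simp
    | succ k ih =>
      intro hk
      have hkN : (k : ℝ) ≤ N := by exact_mod_cast (Nat.le_succ k).trans hk
      have hkn : ‖(k : ℝ) • w‖ ≤ N * ‖w‖ := by
        rw [norm_smul, Real.norm_of_nonneg (Nat.cast_nonneg k)]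
        exact mul_le_mul_of_nonneg_right hkN hwpos.le
      have h1 := (hball (x + (k : ℝ) • w) (by
        rw [Metric.mem_ball, dist_eq_norm, add_sub_cancel_left]; linarith)).2
      rw [add_sub_cancel_left] at h1
      have h2 : Metric.infDist (x + (k : ℝ) • w) s < ‖w‖ := by
        refine h1.trans_lt ?_
        calc 1 / (2 * N) * ‖(k : ℝ) • w‖ ≤ 1 / (2 * N) * (N * ‖w‖) :=
              mul_le_mul_of_nonneg_left hkn (by positivity)
          _ = ‖w‖ / 2 := by field_simp
          _ < ‖w‖ := half_lt_self hwpos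
      obtain ⟨z', hz', hzz⟩ := (Metric.infDist_lt_iff ⟨x, hx⟩).1 h2
      rw [dist_eq_norm] at hzz
      have h3 : ‖z' - x‖ ≤ 2 * (N * ‖w‖) := by
        have : z' - x = (k : ℝ) • w - (x + (k : ℝ) • w - z') := by abel
        rw [this]
        have := norm_sub_le ((k : ℝ) • w) (x + (k : ℝ) • w - z')
        nlinarith
      have h4 := (hball z' (by rw [Metric.mem_ball, dist_eq_norm]; linarith)).1 hz'
      have h5 : ‖a z' - a x - D (z' - x)‖ ≤ 2 * ‖w‖ := by
        refine h4.trans ?_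
        calc 1 / N * ‖z' - x‖ ≤ 1 / N * (2 * (N * ‖w‖)) :=
              mul_le_mul_of_nonneg_left h3 (by positivity)
          _ = 2 * ‖w‖ := by field_simp
      have h6 := h.step hC D k hz' hzz.le h5
      have h7 := ih ((Nat.le_succ k).trans hk)
      rw [← hK] at h6
      have h8 := abs_add_le _ _ |>.trans (add_le_add h6 h7)
      refine le_trans (le_of_eq ?_) (h8.trans (le_of_eq ?_))
      · congr 1; push_cast; ring
      · push_cast; ring
  have hfin := hind N le_rfl
  have hzx' : x + (N : ℝ) • w = z := by rw [← hzw]; abel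
  have e1 : (inner ℝ (a x) (z - x) : ℝ) = N * inner ℝ (a x) w := by
    rw [hzw, real_inner_smul_right]
  have e2 : (inner ℝ (D (z - x)) (z - x) : ℝ) = N * (N * inner ℝ (D w) w) := by
    rw [hzw, map_smul, real_inner_smul_right, real_inner_smul_left]
  rw [hzx'] at hfin
  rw [e1, e2, hwL]
  have e3 : |(inner ℝ (D w) w : ℝ)| ≤ ‖D‖ * ‖w‖ ^ 2 := by
    refine (abs_real_inner_le_norm _ _).trans ?_
    have := D.le_opNorm w
    nlinarith
  have e4 : N * (K + ‖D‖) * ‖w‖ ^ 2 ≤ η * (N * ‖w‖) ^ 2 := by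
    have : N * (K + ‖D‖) * ‖w‖ ^ 2 ≤ N * (η * N) * ‖w‖ ^ 2 := by gcongr
    linarith
  have e5 : |(N : ℝ) / 2 * inner ℝ (D w) w| ≤ N * (‖D‖ * ‖w‖ ^ 2) := by
    rw [abs_mul, abs_of_pos (half_pos hN0)]
    nlinarith [abs_nonneg (inner ℝ (D w) w : ℝ)]
  rw [abs_le] at hfin e5 ⊢
  constructor <;> nlinarith [hfin.1, hfin.2, e5.1, e5.2]

lemma QuadPinched.lipschitzOnWith {C : ℝ} {g : EucSp n → ℝ} {a : EucSp n → EucSp n}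
    {s : Set (EucSp n)} (hC : 0 ≤ C) (h : QuadPinched C g a s) :
    LipschitzOnWith (6 * C).toNNReal a s := by
  refine LipschitzOnWith.of_dist_le_mul fun x hx y hy => ?_
  rw [dist_eq_norm, dist_eq_norm, Real.coe_toNNReal _ (by positivity)]
  exact h.gradient_sub_le hC hx hy

/-- A pinched function is twice differentiable at almost every point of `s`. -/
lemma QuadPinched.ae_expansion {C : ℝ} {g : EucSp n → ℝ} {a : EucSp n → EucSp n}
    {s : Set (EucSp n)} (hC : 0 ≤ C) (h : QuadPinched C g a s) :
    ∀ᵐ x, x ∈ s → ∃ A : SymMat n, ∀ η > (0 : ℝ), ∀ᶠ z in 𝓝 x,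
      |g z - g x - inner ℝ (a x) (z - x) - (1 / 2) * symForm A (z - x) (z - x)|
        ≤ η * ‖z - x‖ ^ 2 := by
  filter_upwards [(h.lipschitzOnWith hC).ae_differentiableWithinAt_of_mem
    (μ := MeasureTheory.volume),
    (Metric.lipschitz_infDist_pt s).ae_differentiableAt (μ := MeasureTheory.volume)] with x h1 h2 hx
  set D := fderivWithin ℝ a s x
  have hD : HasFDerivWithinAt a D s x := (h1 hx).hasFDerivWithinAt
  let I : EucSp n →L[ℝ] EucSp n →L[ℝ] ℝ := innerSL ℝ
  set B : EucSp n →L[ℝ] EucSp n →L[ℝ] ℝ := (1 / 2 : ℝ) • (I.comp D + (I.comp D).flip)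
  have hB : ∀ v w, B v w = (1 / 2) * (inner ℝ (D v) w + inner ℝ (D w) v) :=
    fun v w => rfl
  obtain ⟨A, hA⟩ := exists_symForm_eq B (fun v w => by rw [hB, hB]; ring)
  refine ⟨A, fun η hη => ?_⟩
  have h0 : Metric.infDist x s = 0 := Metric.infDist_zero_of_mem hx
  have hmin : IsLocalMin (fun z => Metric.infDist z s) x :=
    Eventually.of_forall fun z => by
      change Metric.infDist x s ≤ _
      rw [h0]
      exact Metric.infDist_nonneg
  have hs : ∀ ε > (0 : ℝ), ∀ᶠ z in 𝓝 x, Metric.infDist z s ≤ ε * ‖z - x‖ := by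
    intro ε hε
    have h3 := h2.hasFDerivAt
    rw [hmin.fderiv_eq_zero] at h3
    filter_upwards [h3.isLittleO.def hε] with z hz
    rw [h0] at hz
    simpa using (le_abs_self _).trans hz
  filter_upwards [h.expansion hC hx hD hs hη] with z hz
  have : symForm A (z - x) (z - x) = inner ℝ (D (z - x)) (z - x) := by
    rw [hA, hB]; ring
  rwa [this]

lemma exists_supConv_argmax {K : Set (EucSp n)} (hK : IsCompact K) (hne : K.Nonempty)
    {u : EucSp n → ℝ} (hu : UpperSemicontinuousOn u K) (k : ℝ) :
    ∃ Y : EucSp n → EucSp n, ∀ x, Y x ∈ K ∧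
      ∀ y ∈ K, u y - k * ‖x - y‖ ^ 2 ≤ u (Y x) - k * ‖x - Y x‖ ^ 2 := by
  have h : ∀ x, ∃ y₀ ∈ K, ∀ y ∈ K, u y - k * ‖x - y‖ ^ 2 ≤ u y₀ - k * ‖x - y₀‖ ^ 2 := by
    intro x
    have hc : Continuous fun y : EucSp n => -(k * ‖x - y‖ ^ 2) := by fun_prop
    obtain ⟨y₀, hy₀, hmax⟩ := (hu.add (hc.upperSemicontinuous.upperSemicontinuousOn K)).exists_isMaxOn
      hne hK
    refine ⟨y₀, hy₀, fun y hy => ?_⟩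
    have : u y + -(k * ‖x - y‖ ^ 2) ≤ u y₀ + -(k * ‖x - y₀‖ ^ 2) := hmax hy
    linarith
  choose Y hY using h
  exact ⟨Y, hY⟩

lemma supConv_ge {K : Set (EucSp n)} {u : EucSp n → ℝ} {k : ℝ} {Y : EucSp n → EucSp n}
    (hY : ∀ x, Y x ∈ K ∧ ∀ y ∈ K, u y - k * ‖x - y‖ ^ 2 ≤ u (Y x) - k * ‖x - Y x‖ ^ 2)
    (x z : EucSp n) :
    u (Y x) - k * ‖x - Y x‖ ^ 2 + inner ℝ ((2 * k) • (Y x - x)) (z - x) - k * ‖z - x‖ ^ 2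
      ≤ u (Y z) - k * ‖z - Y z‖ ^ 2 := by
  refine le_trans (le_of_eq ?_) ((hY z).2 (Y x) (hY x).1)
  have h1 : z - Y x = (z - x) - (Y x - x) := by abel
  rw [h1, norm_sub_sq_real (z - x) (Y x - x), real_inner_smul_left, norm_sub_rev x (Y x), real_inner_comm (z - x)]
  ring

/-- Second order expansions of a sup-convolution give jets of the original function. -/
lemma QuadSub.mem_of_supConv {S : Set (SymMat n)} (hS : IsSubeq S) {K X : Set (EucSp n)}
    (hX : IsOpen X) (hXK : X ⊆ K) {u : EucSp n → ℝ} (hu : QuadSub S X u) {k : ℝ}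
    {Y : EucSp n → EucSp n}
    (hY : ∀ x, Y x ∈ K ∧ ∀ y ∈ K, u y - k * ‖x - y‖ ^ 2 ≤ u (Y x) - k * ‖x - Y x‖ ^ 2)
    {x a : EucSp n} (hx : Y x ∈ X) {A : SymMat n}
    (hA : ∀ η > (0 : ℝ), ∀ᶠ z in 𝓝 x,
      |(u (Y z) - k * ‖z - Y z‖ ^ 2) - (u (Y x) - k * ‖x - Y x‖ ^ 2) - inner ℝ a (z - x)
        - (1 / 2) * symForm A (z - x) (z - x)| ≤ η * ‖z - x‖ ^ 2) : A ∈ S := by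
  refine hS.mem_of_forall_add one_pos fun η hη _ => ?_
  refine hu (Y x) hx (a - symMap (A + η • 1) (Y x)) _ ?_
  have ht : Tendsto (fun y => x + (y - Y x)) (𝓝 (Y x)) (𝓝 x) := by
    have : Continuous fun y => x + (y - Y x) := by fun_prop
    simpa using this.tendsto (Y x)
  filter_upwards [ht.eventually (hA (η / 2) (by positivity)), hX.mem_nhds hx] with y hy hyX
  have h1 := (hY (x + (y - Y x))).2 y (hXK hyX)
  have h2 : x + (y - Y x) - y = x - Y x := by abel
  rw [h2] at h1
  rw [add_sub_cancel_left] at hy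
  have h3 := (abs_le.1 hy).2
  rw [quadFn_centered a _ (Y x) y, symForm_add, symForm_smul, symForm_one,
    real_inner_self_eq_norm_sq]
  linarith

lemma QuadSub.add_sq {S : Set (SymMat n)} {X : Set (EucSp n)} {u : EucSp n → ℝ}
    (hu : QuadSub S X u) (η : ℝ) (x₀ : EucSp n) :
    QuadSub {A | A - (2 * η) • (1 : SymMat n) ∈ S} X (fun z => u z + η * ‖z - x₀‖ ^ 2) := by
  intro x hx a A hmax
  refine hu x hx (a + (2 * η) • x₀) _ ?_
  filter_upwards [hmax] with z hz
  have h := fun z => quadFn_add_sq (a + (2 * η) • x₀) (A - (2 * η) • 1) η x₀ z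
  simp only [add_sub_cancel_right, sub_add_cancel] at h
  linarith [h z, h x]

lemma IsSubeq.shift {S : Set (SymMat n)} (hS : IsSubeq S) (c : ℝ) :
    IsSubeq {A | A - c • (1 : SymMat n) ∈ S} where
  closed := by
    have : Continuous fun A : SymMat n => A - c • (1 : SymMat n) := by fun_prop
    exact hS.closed.preimage this
  mono A hA B h := hS.mono _ hA _ fun x => by
    rw [symForm_sub, symForm_sub]; linarith [h x]

lemma volume_image_eq_zero_of_lipschitzOnWith {E : Set (EucSp n)} {f : EucSp n → EucSp n}
    {L : NNReal} (hf : LipschitzOnWith L f E) (hE : MeasureTheory.volume E = 0) :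
    MeasureTheory.volume (f '' E) = 0 := by
  set μ : MeasureTheory.Measure (EucSp n) :=
    MeasureTheory.Measure.hausdorffMeasure (Module.finrank ℝ (EucSp n)) with hμ
  have h1 : μ E = 0 := MeasureTheory.Measure.absolutelyContinuous_isAddHaarMeasure μ MeasureTheory.volume hE
  have h2 : μ (f '' E) = 0 := by
    have := hf.hausdorffMeasure_image_le (d := Module.finrank ℝ (EucSp n)) (Nat.cast_nonneg _)
    rw [← hμ, h1, mul_zero] at this
    exact le_antisymm this bot_le
  exact MeasureTheory.Measure.absolutelyContinuous_isAddHaarMeasure MeasureTheory.volume μ h2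

lemma exists_gap {K X : Set (EucSp n)} (hK : IsCompact K) (hX : IsOpen X)
    {u v : EucSp n → ℝ} (hu : UpperSemicontinuousOn u K) (hv : UpperSemicontinuousOn v K)
    {m : ℝ} (hm : ∀ y ∈ K \ X, u y + v y < m) :
    ∃ r > (0 : ℝ), ∀ y ∈ K, ∀ y' ∈ K, ‖y - y'‖ < r → m ≤ u y + v y' → y ∈ X ∧ y' ∈ X := by
  have husc : UpperSemicontinuousOn (fun p : EucSp n × EucSp n => u p.1 + v p.2) (K ×ˢ K) :=
    (hu.comp continuousOn_fst fun p hp => hp.1).add (hv.comp continuousOn_snd fun p hp => hp.2)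
  have hT : IsCompact (((K ×ˢ K) ∩ (fun p : EucSp n × EucSp n => u p.1 + v p.2) ⁻¹' Set.Ici m)
      ∩ (X ×ˢ X)ᶜ) :=
    (husc.isCompact_inter_preimage_Ici (hK.prod hK) m).inter_right (hX.prod hX).isClosed_compl
  rcases Set.eq_empty_or_nonempty (((K ×ˢ K) ∩
    (fun p : EucSp n × EucSp n => u p.1 + v p.2) ⁻¹' Set.Ici m) ∩ (X ×ˢ X)ᶜ) with he | hne
  · refine ⟨1, one_pos, fun y hy y' hy' _ h => ?_⟩
    by_contra hcon
    have : (y, y') ∈ (∅ : Set (EucSp n × EucSp n)) := he ▸ ⟨⟨⟨hy, hy'⟩, h⟩, hcon⟩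
    exact this
  · obtain ⟨p, hp, hmin⟩ := hT.exists_isMinOn hne
      (f := fun p : EucSp n × EucSp n => ‖p.1 - p.2‖) (by fun_prop)
    refine ⟨‖p.1 - p.2‖, norm_pos_iff.2 (sub_ne_zero.2 fun h => ?_),
      fun y hy y' hy' hlt h => ?_⟩
    · have h1 : m ≤ u p.1 + v p.2 := hp.1.2
      have h2 : p.1 ∉ X := fun h3 => hp.2 ⟨h3, h ▸ h3⟩
      have := hm p.1 ⟨hp.1.1.1, h2⟩
      rw [← h] at h1
      linarith
    · by_contra hcon
      have := hmin (a := (y, y')) ⟨⟨⟨hy, hy'⟩, h⟩, hcon⟩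
      exact absurd hlt (not_lt.2 this)

lemma norm_sq_add_norm_sq_add_inner {k : ℝ} (hk : 0 < k) (z y y' p : EucSp n) :
    k * ‖z - y‖ ^ 2 + k * ‖z - y'‖ ^ 2 + inner ℝ p z =
      2 * k * ‖z - ((1 / 2 : ℝ) • (y + y') - (1 / (4 * k)) • p)‖ ^ 2 + k / 2 * ‖y - y'‖ ^ 2 +
        (1 / 2) * inner ℝ p (y + y') - ‖p‖ ^ 2 / (8 * k) := by
  simp only [← real_inner_self_eq_norm_sq, inner_sub_left, inner_sub_right, inner_add_left,
    inner_add_right, real_inner_smul_left, real_inner_smul_right]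
  rw [real_inner_comm z y, real_inner_comm z y', real_inner_comm z p, real_inner_comm y p,
    real_inner_comm y' p, real_inner_comm y y']
  field_simp
  ring

lemma symForm_nonpos_of_expansion {A : SymMat n} {x : EucSp n}
    (h : ∀ η > (0 : ℝ), ∀ᶠ z in 𝓝 x, symForm A (z - x) (z - x) ≤ η * ‖z - x‖ ^ 2)
    (w : EucSp n) : symForm A w w ≤ 0 := by
  refine le_of_forall_pos_le_add fun ε hε => ?_
  have hη : 0 < ε / (‖w‖ ^ 2 + 1) := by positivity
  have ht : Tendsto (fun s : ℝ => x + s • w) (𝓝[>] 0) (𝓝 x) := by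
    have : Continuous fun s : ℝ => x + s • w := by fun_prop
    simpa using (this.tendsto 0).mono_left (nhdsWithin_le_nhds (s := Set.Ioi 0))
  obtain ⟨s, hs, hs0⟩ := ((ht.eventually (h _ hη)).and self_mem_nhdsWithin).exists
  rw [add_sub_cancel_left, symForm_smul_left, symForm_smul_right, norm_smul, mul_pow,
    Real.norm_eq_abs, sq_abs] at hs
  have hs0' : 0 < s := hs0
  have h1 : s ^ 2 * symForm A w w ≤ s ^ 2 * (ε / (‖w‖ ^ 2 + 1) * ‖w‖ ^ 2) := by nlinarith
  have h2 := le_of_mul_le_mul_left h1 (by positivity)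
  have h3 : ε / (‖w‖ ^ 2 + 1) * ‖w‖ ^ 2 ≤ ε := by
    rw [div_mul_eq_mul_div, div_le_iff₀ (by positivity)]
    nlinarith
  linarith

/-- If the quadratically pinched sum of two sup-convolutions touches affine functions from below
at every point of `E`, with slopes filling an open ball, then at some point of `E` both have
second order expansions whose Hessians sum to a nonpositive form. -/
lemma exists_expansions {g₁ g₂ : EucSp n → ℝ} {a₁ a₂ : EucSp n → EucSp n} {k r : ℝ} (hk : 0 < k)
    (hr : 0 < r)
    (h₁ : ∀ x z, g₁ x + inner ℝ (a₁ x) (z - x) - k * ‖z - x‖ ^ 2 ≤ g₁ z)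
    (h₂ : ∀ x z, g₂ x + inner ℝ (a₂ x) (z - x) - k * ‖z - x‖ ^ 2 ≤ g₂ z)
    (hball : ∀ p : EucSp n, ‖p‖ < r → ∃ x, ∀ z, g₁ z + g₂ z ≤ g₁ x + g₂ x + inner ℝ p (z - x)) :
    ∃ x p : EucSp n, ∃ A B : SymMat n, ‖p‖ < r ∧
      (∀ z, g₁ z + g₂ z ≤ g₁ x + g₂ x + inner ℝ p (z - x)) ∧
      (∀ η > (0 : ℝ), ∀ᶠ z in 𝓝 x, |g₁ z - g₁ x - inner ℝ (a₁ x) (z - x)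
        - (1 / 2) * symForm A (z - x) (z - x)| ≤ η * ‖z - x‖ ^ 2) ∧
      (∀ η > (0 : ℝ), ∀ᶠ z in 𝓝 x, |g₂ z - g₂ x - inner ℝ (a₂ x) (z - x)
        - (1 / 2) * symForm B (z - x) (z - x)| ≤ η * ‖z - x‖ ^ 2) ∧
      ∀ w, symForm (A + B) w w ≤ 0 := by
  set E : Set (EucSp n) := {x | ∃ p : EucSp n, ‖p‖ < r ∧
    ∀ z, g₁ z + g₂ z ≤ g₁ x + g₂ x + inner ℝ p (z - x)} with hE
  have hslope : ∀ x p : EucSp n, (∀ z, g₁ z + g₂ z ≤ g₁ x + g₂ x + inner ℝ p (z - x)) →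
      a₁ x + a₂ x = p := by
    intro x p hp
    set d := a₁ x + a₂ x - p with hd
    have h3 := h₁ x (x + (1 / (4 * k)) • d)
    have h4 := h₂ x (x + (1 / (4 * k)) • d)
    have h5 := hp (x + (1 / (4 * k)) • d)
    rw [add_sub_cancel_left, real_inner_smul_right, norm_smul, mul_pow,
      Real.norm_of_nonneg (by positivity : (0 : ℝ) ≤ 1 / (4 * k))] at h3 h4
    rw [add_sub_cancel_left, real_inner_smul_right] at h5
    have h6 : (inner ℝ (a₁ x) d : ℝ) + inner ℝ (a₂ x) d - inner ℝ p d = ‖d‖ ^ 2 := by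
      rw [← inner_add_left, ← inner_sub_left, ← hd, real_inner_self_eq_norm_sq]
    have h7 : 1 / (4 * k) * (inner ℝ (a₁ x) d + inner ℝ (a₂ x) d - inner ℝ p d)
        ≤ 2 * k * ((1 / (4 * k)) ^ 2 * ‖d‖ ^ 2) := by linarith
    rw [h6] at h7
    have h8 : 2 * k * ((1 / (4 * k)) ^ 2 * ‖d‖ ^ 2) = 1 / (8 * k) * ‖d‖ ^ 2 := by
      field_simp; ring
    have h9 : 1 / (4 * k) * ‖d‖ ^ 2 = 2 * (1 / (8 * k) * ‖d‖ ^ 2) := by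
      field_simp; ring
    have h10 : 1 / (8 * k) * ‖d‖ ^ 2 ≤ 0 := by linarith
    have h11 : ‖d‖ ^ 2 ≤ 0 := by
      by_contra hcon
      have : 0 < 1 / (8 * k) * ‖d‖ ^ 2 := by push Not at hcon; positivity
      linarith
    have h12 : ‖d‖ = 0 := by nlinarith [norm_nonneg d]
    exact sub_eq_zero.1 (norm_eq_zero.1 h12)
  have hpin₁ : QuadPinched k g₁ a₁ E := by
    rintro x ⟨p, -, hp⟩ z
    have h3 := hp z
    rw [← hslope x p hp, inner_add_left] at h3
    rw [abs_le]
    constructor <;> linarith [h₁ x z, h₂ x z]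
  have hpin₂ : QuadPinched k g₂ a₂ E := by
    rintro x ⟨p, -, hp⟩ z
    have h3 := hp z
    rw [← hslope x p hp, inner_add_left] at h3
    rw [abs_le]
    constructor <;> linarith [h₁ x z, h₂ x z]
  have hvol : MeasureTheory.volume E ≠ 0 := by
    intro h0
    have hlip := (hpin₁.lipschitzOnWith hk.le).add (hpin₂.lipschitzOnWith hk.le)
    have h3 := volume_image_eq_zero_of_lipschitzOnWith hlip h0
    have h4 : Metric.ball (0 : EucSp n) r ⊆ (fun x => a₁ x + a₂ x) '' E := by
      intro p hp
      rw [mem_ball_zero_iff] at hp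
      obtain ⟨x, hx⟩ := hball p hp
      exact ⟨x, ⟨p, hp, hx⟩, hslope x p hx⟩
    exact (Metric.measure_ball_pos MeasureTheory.volume (0 : EucSp n) hr).ne'
      (MeasureTheory.measure_mono_null h4 h3)
  have hex : ∃ x ∈ E, (x ∈ E → ∃ A : SymMat n, ∀ η > (0 : ℝ), ∀ᶠ z in 𝓝 x,
      |g₁ z - g₁ x - inner ℝ (a₁ x) (z - x) - (1 / 2) * symForm A (z - x) (z - x)|
        ≤ η * ‖z - x‖ ^ 2) ∧ (x ∈ E → ∃ A : SymMat n, ∀ η > (0 : ℝ), ∀ᶠ z in 𝓝 x,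
      |g₂ z - g₂ x - inner ℝ (a₂ x) (z - x) - (1 / 2) * symForm A (z - x) (z - x)|
        ≤ η * ‖z - x‖ ^ 2) := by
    by_contra hcon
    refine hvol (MeasureTheory.measure_mono_null ?_ (MeasureTheory.ae_iff.1
      ((hpin₁.ae_expansion hk.le).and (hpin₂.ae_expansion hk.le))))
    exact fun x hx hx' => hcon ⟨x, hx, hx'.1, hx'.2⟩
  obtain ⟨x, hx, hA, hB⟩ := hex
  obtain ⟨A, hA⟩ := hA hx
  obtain ⟨B, hB⟩ := hB hx
  obtain ⟨p, hpr, hp⟩ := hx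
  refine ⟨x, p, A, B, hpr, hp, hA, hB, symForm_nonpos_of_expansion (x := x) fun η hη => ?_⟩
  filter_upwards [hA (η / 4) (by positivity), hB (η / 4) (by positivity)] with z hz₁ hz₂
  have h3 := hp z
  rw [← hslope x p hp, inner_add_left] at h3
  rw [symForm_add]
  linarith [(abs_le.1 hz₁).1, (abs_le.1 hz₂).1]

/-- The theorem on sums for semicontinuous functions, without gradient terms. -/
lemma exists_jets_of_interior_max {S T : Set (SymMat n)} (hS : IsSubeq S) (hT : IsSubeq T)
    {K X : Set (EucSp n)} (hK : IsCompact K) (hX : IsOpen X) (hXK : X ⊆ K) {u v : EucSp n → ℝ}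
    (hu : UpperSemicontinuousOn u K) (hv : UpperSemicontinuousOn v K)
    (huS : QuadSub S X u) (hvT : QuadSub T X v) {m : ℝ} (hm : ∀ y ∈ K \ X, u y + v y < m)
    {x₀ : EucSp n} (hx₀ : x₀ ∈ K) (hmx : m < u x₀ + v x₀) :
    ∃ A ∈ S, ∃ B ∈ T, ∀ w, symForm (A + B) w w ≤ 0 := by
  obtain ⟨r, hr, hgap⟩ := exists_gap hK hX hu hv hm
  obtain ⟨Mu, hMu⟩ := hu.bddAbove_of_isCompact hK
  obtain ⟨Mv, hMv⟩ := hv.bddAbove_of_isCompact hK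
  obtain ⟨R, hR, hKR⟩ := hK.isBounded.exists_pos_norm_le
  have hne : K.Nonempty := ⟨x₀, hx₀⟩
  set M := Mu + Mv with hM
  set m₀ := u x₀ + v x₀ with hm₀
  set r₀ := min 1 ((m₀ - m) / (2 * R + 1)) with hr₀
  have hr₀pos : 0 < r₀ := lt_min one_pos (div_pos (by linarith) (by positivity))
  have hr₀1 : r₀ ≤ 1 := min_le_left _ _
  have hr₀2 : r₀ * (2 * R + 1) ≤ m₀ - m := by
    rw [← le_div_iff₀ (by positivity)]; exact min_le_right _ _
  set k := max 1 (4 * (M - m) / r ^ 2 + 1) with hk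
  have hk1 : 1 ≤ k := le_max_left _ _
  have hk0 : 0 < k := by linarith
  have hk2 : 4 * (M - m) < k * r ^ 2 := by
    rw [← div_lt_iff₀ (by positivity)]
    exact (lt_add_one _).trans_le (le_max_right _ _)
  obtain ⟨Y₁, hY₁⟩ := exists_supConv_argmax hK hne hu k
  obtain ⟨Y₂, hY₂⟩ := exists_supConv_argmax hK hne hv k
  have hball : ∀ p : EucSp n, ‖p‖ < r₀ → ∃ x, ∀ z,
      (u (Y₁ z) - k * ‖z - Y₁ z‖ ^ 2) + (v (Y₂ z) - k * ‖z - Y₂ z‖ ^ 2) ≤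
      (u (Y₁ x) - k * ‖x - Y₁ x‖ ^ 2) + (v (Y₂ x) - k * ‖x - Y₂ x‖ ^ 2) + inner ℝ p (z - x) := by
    intro p _
    have husc : UpperSemicontinuousOn (fun q : EucSp n × EucSp n => u q.1 + v q.2) (K ×ˢ K) :=
      (hu.comp continuousOn_fst fun p hp => hp.1).add (hv.comp continuousOn_snd fun p hp => hp.2)
    have hc : Continuous fun q : EucSp n × EucSp n =>
        -(k / 2 * ‖q.1 - q.2‖ ^ 2 + (1 / 2) * inner ℝ p (q.1 + q.2)) := by fun_prop
    obtain ⟨q, hq, hmax⟩ := (husc.add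
      (hc.upperSemicontinuous.upperSemicontinuousOn _)).exists_isMaxOn (hne.prod hne)
      (hK.prod hK)
    refine ⟨(1 / 2 : ℝ) • (q.1 + q.2) - (1 / (4 * k)) • p, fun z => ?_⟩
    set x := (1 / 2 : ℝ) • (q.1 + q.2) - (1 / (4 * k)) • p with hx
    have e1 := norm_sq_add_norm_sq_add_inner hk0 z (Y₁ z) (Y₂ z) p
    have e2 := norm_sq_add_norm_sq_add_inner hk0 x q.1 q.2 p
    rw [← hx, sub_self, norm_zero] at e2
    have e3 : u (Y₁ z) + v (Y₂ z) +
        -(k / 2 * ‖Y₁ z - Y₂ z‖ ^ 2 + (1 / 2) * inner ℝ p (Y₁ z + Y₂ z)) ≤ u q.1 + v q.2 +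
        -(k / 2 * ‖q.1 - q.2‖ ^ 2 + (1 / 2) * inner ℝ p (q.1 + q.2)) :=
      hmax (a := (Y₁ z, Y₂ z)) ⟨(hY₁ z).1, (hY₂ z).1⟩
    have e4 := (hY₁ x).2 q.1 hq.1
    have e5 := (hY₂ x).2 q.2 hq.2
    have e6 : 0 ≤ 2 * k * ‖z - ((1 / 2 : ℝ) • (Y₁ z + Y₂ z) - (1 / (4 * k)) • p)‖ ^ 2 := by
      positivity
    rw [inner_sub_right]
    linarith
  obtain ⟨x, p, A, B, hp, hx, hA, hB, hAB⟩ := exists_expansions hk0 hr₀pos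
    (supConv_ge hY₁) (supConv_ge hY₂) hball
  have h1 := hx x₀
  have h2 := (hY₁ x₀).2 x₀ hx₀
  have h3 := (hY₂ x₀).2 x₀ hx₀
  rw [sub_self, norm_zero] at h2 h3
  have h4 : -(inner ℝ p (x₀ - x)) ≥ -(r₀ * (‖x - Y₁ x‖ + 2 * R)) := by
    have f1 := (abs_le.1 (abs_real_inner_le_norm p (x₀ - x))).2
    have f2 : ‖x₀ - x‖ ≤ ‖x - Y₁ x‖ + 2 * R := by
      have : x₀ - x = x₀ - Y₁ x - (x - Y₁ x) := by abel
      rw [this]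
      linarith [norm_sub_le (x₀ - Y₁ x) (x - Y₁ x), norm_sub_le x₀ (Y₁ x), hKR _ hx₀,
        hKR _ (hY₁ x).1]
    have f3 : ‖p‖ * ‖x₀ - x‖ ≤ r₀ * (‖x - Y₁ x‖ + 2 * R) :=
      mul_le_mul hp.le f2 (norm_nonneg _) hr₀pos.le
    linarith
  have h5 : ‖Y₁ x - Y₂ x‖ ^ 2 ≤ 2 * ‖x - Y₁ x‖ ^ 2 + 2 * ‖x - Y₂ x‖ ^ 2 := by
    have : Y₁ x - Y₂ x = (x - Y₂ x) - (x - Y₁ x) := by abel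
    rw [this]
    have := parallelogram_law_with_norm ℝ (x - Y₂ x) (x - Y₁ x)
    nlinarith [norm_nonneg ((x - Y₂ x) + (x - Y₁ x))]
  have h6 : k / 2 * ‖x - Y₁ x‖ ^ 2 - r₀ * ‖x - Y₁ x‖ ≥ -r₀ := by
    have f1 : 1 / 2 * ‖x - Y₁ x‖ ^ 2 ≤ k / 2 * ‖x - Y₁ x‖ ^ 2 :=
      mul_le_mul_of_nonneg_right (by linarith) (by positivity)
    nlinarith [sq_nonneg (‖x - Y₁ x‖ - r₀)]
  have h7 : k / 4 * ‖Y₁ x - Y₂ x‖ ^ 2 ≤ k / 2 * ‖x - Y₁ x‖ ^ 2 + k / 2 * ‖x - Y₂ x‖ ^ 2 := by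
    have := mul_le_mul_of_nonneg_left h5 (by positivity : 0 ≤ k / 4)
    linarith
  have h8 : 0 ≤ k / 2 * ‖x - Y₂ x‖ ^ 2 := by positivity
  have h9 : m + k / 4 * ‖Y₁ x - Y₂ x‖ ^ 2 ≤ u (Y₁ x) + v (Y₂ x) := by linarith
  have h10 : u (Y₁ x) + v (Y₂ x) ≤ M :=
    add_le_add (hMu ⟨_, (hY₁ x).1, rfl⟩) (hMv ⟨_, (hY₂ x).1, rfl⟩)
  have h11 : ‖Y₁ x - Y₂ x‖ < r := by
    refine lt_of_pow_lt_pow_left₀ 2 hr.le ?_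
    have : k * ‖Y₁ x - Y₂ x‖ ^ 2 < k * r ^ 2 := by linarith
    exact lt_of_mul_lt_mul_left this hk0.le
  have h12 : 0 ≤ k / 4 * ‖Y₁ x - Y₂ x‖ ^ 2 := by positivity
  obtain ⟨hX₁, hX₂⟩ := hgap _ (hY₁ x).1 _ (hY₂ x).1 h11 (by linarith)
  exact ⟨A, huS.mem_of_supConv hS hX hXK hY₁ hX₁ hA, B, hvT.mem_of_supConv hT hX hXK hY₂ hX₂ hB,
    hAB⟩

/-- Comparison principle. -/
theorem QuadSub.comparison {S : Set (SymMat n)} (hS : IsSubeq S)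
    {K X : Set (EucSp n)} (hK : IsCompact K) (hX : IsOpen X) (hXK : X ⊆ K) {u v : EucSp n → ℝ}
    (hu : UpperSemicontinuousOn u K) (hv : UpperSemicontinuousOn v K)
    (huS : QuadSub S X u) (hvS : QuadSub (dualSet S) X v) (h : ∀ y ∈ K \ X, u y + v y ≤ 0) :
    ∀ y ∈ K, u y + v y ≤ 0 := by
  by_contra! hcon
  obtain ⟨x₀, hx₀, hpos⟩ := hcon
  obtain ⟨R, hR, hKR⟩ := hK.isBounded.exists_pos_norm_le
  set m := u x₀ + v x₀ with hm
  set ε := m / (16 * R ^ 2) with hε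
  have hεpos : 0 < ε := by positivity
  have hc : Continuous fun z : EucSp n => ε * ‖z - x₀‖ ^ 2 := by fun_prop
  have hbd : ∀ y ∈ K \ X, u y + ε * ‖y - x₀‖ ^ 2 + v y < m / 2 := by
    intro y hy
    have h1 := h y hy
    have h2 : ‖y - x₀‖ ≤ 2 * R := by
      linarith [norm_sub_le y x₀, hKR _ hx₀, hKR _ hy.1]
    have h3 : ε * ‖y - x₀‖ ^ 2 ≤ ε * (2 * R) ^ 2 := by gcongr
    have h4 : ε * (2 * R) ^ 2 = m / 4 := by rw [hε]; field_simp; norm_num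
    linarith
  obtain ⟨A, hA, B, hB, hAB⟩ := exists_jets_of_interior_max (hS.shift (2 * ε)) hS.dual hK hX hXK
    (hu.add (hc.upperSemicontinuous.upperSemicontinuousOn K)) hv (huS.add_sq ε x₀) hvS
    hbd hx₀ (by rw [sub_self, norm_zero]; linarith)
  refine hB (hS.mem_interior (η := 2 * ε) (by positivity) hA fun w => ?_)
  have := hAB w
  rw [symForm_add] at this
  rw [symForm_sub, symForm_smul, symForm_one, real_inner_self_eq_norm_sq, symForm_neg]
  linarith

lemma IsLocalMax.of_touch {f g : EucSp n → ℝ} {x : EucSp n} (h : IsLocalMax g x)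
    (hle : ∀ᶠ z in 𝓝 x, f z ≤ g z) (hx : f x = g x) : IsLocalMax f x := by
  filter_upwards [h, hle] with z h1 h2
  linarith

lemma QuadSub.mono_set {S : Set (SymMat n)} {X Y : Set (EucSp n)} {u : EucSp n → ℝ}
    (h : QuadSub S X u) (hYX : Y ⊆ X) : QuadSub S Y u := fun x hx => h x (hYX hx)

lemma QuadSub.congr {S : Set (SymMat n)} {X : Set (EucSp n)} (hX : IsOpen X) {u v : EucSp n → ℝ}
    (h : QuadSub S X u) (huv : ∀ x ∈ X, u x = v x) : QuadSub S X v := by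
  intro x hx a A hmax
  refine h x hx a A (hmax.of_touch ?_ (by rw [huv x hx]))
  filter_upwards [hX.mem_nhds hx] with z hz
  rw [huv z hz]

lemma QuadSub.max {S : Set (SymMat n)} {X : Set (EucSp n)} {u v : EucSp n → ℝ}
    (hu : QuadSub S X u) (hv : QuadSub S X v) : QuadSub S X (fun z => max (u z) (v z)) := by
  intro x hx a A hmax
  rcases max_choice (u x) (v x) with h | h
  · exact hu x hx a A (hmax.of_touch (Eventually.of_forall fun z => by simp) (by simp [h]))
  · exact hv x hx a A (hmax.of_touch (Eventually.of_forall fun z => by simp) (by simp [h]))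

lemma QuadSub.add_const {S : Set (SymMat n)} {X : Set (EucSp n)} {u : EucSp n → ℝ}
    (hu : QuadSub S X u) (c : ℝ) : QuadSub S X (fun z => u z + c) := by
  intro x hx a A hmax
  refine hu x hx a A ?_
  filter_upwards [hmax] with z hz
  linarith

lemma QuadSub.const_mul {S : Set (SymMat n)} (hS : ∀ A ∈ S, ∀ t : ℝ, 0 < t → t • A ∈ S)
    {X : Set (EucSp n)} {u : EucSp n → ℝ} (hu : QuadSub S X u) {c : ℝ} (hc : 0 < c) :
    QuadSub S X (fun z => c * u z) := by
  intro x hx a A hmax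
  have := hS _ (hu x hx (c⁻¹ • a) (c⁻¹ • A) ?_) c hc
  · rwa [smul_smul, mul_inv_cancel₀ hc.ne', one_smul] at this
  · filter_upwards [hmax] with z hz
    rw [quadFn_smul, quadFn_smul]
    have := mul_le_mul_of_nonneg_left hz (inv_pos.2 hc).le
    rw [mul_sub, mul_sub, inv_mul_cancel_left₀ hc.ne', inv_mul_cancel_left₀ hc.ne'] at this
    exact this

lemma symForm_nonpos_of_isLocalMax {a x : EucSp n} {A : SymMat n}
    (h : IsLocalMax (quadFn a A) x) (w : EucSp n) : symForm A w w ≤ 0 := by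
  have ht : Tendsto (fun s : ℝ => x + s • w) (𝓝[>] 0) (𝓝 x) := by
    have : Continuous fun s : ℝ => x + s • w := by fun_prop
    simpa using (this.tendsto 0).mono_left (nhdsWithin_le_nhds (s := Set.Ioi 0))
  have ht' : Tendsto (fun s : ℝ => x + s • (-w)) (𝓝[>] 0) (𝓝 x) := by
    have : Continuous fun s : ℝ => x + s • (-w) := by fun_prop
    simpa using (this.tendsto 0).mono_left (nhdsWithin_le_nhds (s := Set.Ioi 0))
  obtain ⟨s, ⟨h1, h2⟩, hs⟩ := (((ht.eventually h).and (ht'.eventually h)).and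
    self_mem_nhdsWithin).exists
  have hs' : 0 < s := hs
  rw [quadFn_expand a A x, add_sub_cancel_left] at h1 h2
  rw [symForm_smul_left, symForm_smul_right, real_inner_smul_right] at h1 h2
  have e1 : symForm A (-w) (-w) = symForm A w w := by
    rw [← neg_one_smul ℝ w, symForm_smul_left, symForm_smul_right]; ring
  rw [e1, inner_neg_right] at h2
  by_contra hcon
  push Not at hcon
  nlinarith [mul_pos (mul_pos hs' hs') hcon]

lemma quadSub_quadFn {S : Set (SymMat n)} (hS : IsSubeq S) (X : Set (EucSp n)) (b : EucSp n)
    {B : SymMat n} (hB : B ∈ S) : QuadSub S X (quadFn b B) := by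
  intro x _ a A hmax
  refine hS.mono B hB A fun w => ?_
  have h : IsLocalMax (quadFn (b + -a) (B + -A)) x := by
    filter_upwards [hmax] with z hz
    rw [quadFn_add, quadFn_add, quadFn_neg, quadFn_neg]
    linarith
  have := symForm_nonpos_of_isLocalMax h w
  rw [symForm_add, symForm_neg] at this
  linarith

/-- `u` outside `O`, and the maximum of `u` and `g` inside. -/
def spliceMax (O : Set (EucSp n)) (u g : EucSp n → ℝ) (z : EucSp n) : ℝ :=
  if z ∈ O then max (u z) (g z) else u z

lemma le_spliceMax (O : Set (EucSp n)) (u g : EucSp n → ℝ) (z : EucSp n) :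
    u z ≤ spliceMax O u g z := by
  unfold spliceMax; split_ifs <;> simp

lemma QuadSub.spliceMax {S : Set (SymMat n)} {X O : Set (EucSp n)} (hO : IsOpen O)
    {u g : EucSp n → ℝ} (hu : QuadSub S X u) (hg : QuadSub S (X ∩ O) g) :
    QuadSub S X (spliceMax O u g) := by
  intro x hx a A hmax
  by_cases hxO : x ∈ O
  · have hev : ∀ᶠ z in 𝓝 x, _root_.spliceMax O u g z = Max.max (u z) (g z) := by
      filter_upwards [hO.mem_nhds hxO] with z hz
      simp [_root_.spliceMax, hz]
    have hx' := hev.self_of_nhds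
    rcases max_choice (u x) (g x) with h | h
    · exact hu x hx a A (hmax.of_touch (hev.mono fun z hz => by simp [hz]) (by rw [hx', h]))
    · exact hg x ⟨hx, hxO⟩ a A
        (hmax.of_touch (hev.mono fun z hz => by simp [hz]) (by rw [hx', h]))
  · refine hu x hx a A (hmax.of_touch (Eventually.of_forall fun z => ?_)
      (by simp [_root_.spliceMax, hxO]))
    linarith [le_spliceMax O u g z]

lemma upperSemicontinuousOn_spliceMax {K O C : Set (EucSp n)} (hO : IsOpen O) (hC : IsClosed C)
    (hCO : C ⊆ O) {u g : EucSp n → ℝ} (hu : UpperSemicontinuousOn u K) (hg : Continuous g)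
    (hgu : ∀ z ∈ K, z ∈ O → z ∉ C → g z ≤ u z) :
    UpperSemicontinuousOn (spliceMax O u g) K := by
  intro x hx y hy
  by_cases hxO : x ∈ O
  · have h1 : max (u x) (g x) < y := by simpa [spliceMax, hxO] using hy
    have h2 := hu x hx y ((le_max_left _ _).trans_lt h1)
    have h3 : ∀ᶠ z in 𝓝[K] x, g z < y := nhdsWithin_le_nhds
      (hg.continuousAt.eventually_lt continuousAt_const ((le_max_right _ _).trans_lt h1))
    filter_upwards [h2, h3, nhdsWithin_le_nhds (hO.mem_nhds hxO)] with z h4 h5 h6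
    simp [spliceMax, h6, h4, h5]
  · have h1 : u x < y := by simpa [spliceMax, hxO] using hy
    filter_upwards [hu x hx y h1, nhdsWithin_le_nhds
      (hC.isOpen_compl.mem_nhds fun h => hxO (hCO h)), self_mem_nhdsWithin] with z h4 h5 h6
    by_cases hz : z ∈ O
    · simp [spliceMax, hz, h4, (hgu z h6 hz h5).trans_lt h4]
    · simp [spliceMax, hz, h4]

/-- Upper semicontinuous envelope relative to `K`. -/
def uscEnvelope (K : Set (EucSp n)) (f : EucSp n → ℝ) (x : EucSp n) : ℝ :=
  sInf {c | ∀ᶠ z in 𝓝[K] x, f z ≤ c}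

lemma uscEnvelope_bddBelow {K : Set (EucSp n)} {f : EucSp n → ℝ} {x : EucSp n} (hx : x ∈ K) :
    BddBelow {c | ∀ᶠ z in 𝓝[K] x, f z ≤ c} :=
  ⟨f x, fun c (hc : ∀ᶠ z in 𝓝[K] x, f z ≤ c) => hc.self_of_nhdsWithin hx⟩

lemma uscEnvelope_le {K : Set (EucSp n)} {f : EucSp n → ℝ} {x : EucSp n} (hx : x ∈ K) {c : ℝ}
    (h : ∀ᶠ z in 𝓝[K] x, f z ≤ c) : uscEnvelope K f x ≤ c :=
  csInf_le (uscEnvelope_bddBelow hx) h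

lemma le_uscEnvelope {K : Set (EucSp n)} {f : EucSp n → ℝ} {x : EucSp n} (hx : x ∈ K) {M : ℝ}
    (hM : ∀ z ∈ K, f z ≤ M) : f x ≤ uscEnvelope K f x :=
  le_csInf ⟨M, eventually_nhdsWithin_of_forall hM⟩ fun c (hc : ∀ᶠ z in 𝓝[K] x, f z ≤ c) =>
    hc.self_of_nhdsWithin hx

lemma upperSemicontinuousOn_uscEnvelope {K : Set (EucSp n)} {f : EucSp n → ℝ} {M : ℝ}
    (hM : ∀ z ∈ K, f z ≤ M) : UpperSemicontinuousOn (uscEnvelope K f) K := by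
  intro x hx y hy
  obtain ⟨c, hc, hcy⟩ := exists_lt_of_csInf_lt ⟨M, eventually_nhdsWithin_of_forall hM⟩ hy
  filter_upwards [eventually_eventually_nhdsWithin.2 hc, self_mem_nhdsWithin] with z hz hzK
  exact (uscEnvelope_le hzK hz).trans_lt hcy

lemma uscEnvelope_frequently {K : Set (EucSp n)} {f : EucSp n → ℝ} {x : EucSp n} (hx : x ∈ K)
    {c : ℝ} (h : c < uscEnvelope K f x) : ∃ᶠ z in 𝓝[K] x, c < f z := by
  intro hcon
  exact absurd (uscEnvelope_le hx (hcon.mono fun z hz => not_lt.1 hz)) (not_le.2 h)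

/-- The envelope of a pointwise supremum of subharmonics is subharmonic. -/
lemma quadSub_uscEnvelope {S : Set (SymMat n)} (hS : IsSubeq S) {K X : Set (EucSp n)}
    (hX : IsOpen X) (hXK : X ⊆ K) {V : Set (EucSp n → ℝ)}
    (hV : ∀ v ∈ V, UpperSemicontinuousOn v K ∧ QuadSub S X v) {H : EucSp n → ℝ} {M : ℝ}
    (hM : ∀ z ∈ K, H z ≤ M) (hVH : ∀ v ∈ V, ∀ z ∈ K, v z ≤ H z)
    (hHV : ∀ z ∈ K, ∀ c < H z, ∃ v ∈ V, c < v z) : QuadSub S X (uscEnvelope K H) := by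
  intro x hx a A hmax
  refine hS.mem_of_forall_add one_pos fun ζ hζ _ => ?_
  set η := ζ / 2 with hη
  have hηpos : 0 < η := by positivity
  have hζη : ζ = 2 * η := by rw [hη]; ring
  obtain ⟨r, hr, hball⟩ := Metric.nhds_basis_closedBall.mem_iff.1
    (inter_mem hmax (hX.mem_nhds hx))
  set q : EucSp n → ℝ := fun z => quadFn a A z + η * ‖z - x‖ ^ 2 with hq
  have hqc : Continuous q := by
    have := continuous_quadFn a A
    fun_prop
  set c := uscEnvelope K H x - quadFn a A x with hc
  have hqx : q x = quadFn a A x := by simp [hq]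
  have hfreq := uscEnvelope_frequently (hXK hx)
    (show uscEnvelope K H x - η * r ^ 2 / 4 < uscEnvelope K H x by
      have : 0 < η * r ^ 2 := by positivity
      linarith)
  have hqev : ∀ᶠ z in 𝓝[K] x, q z < quadFn a A x + η * r ^ 2 / 4 := by
    refine nhdsWithin_le_nhds (hqc.continuousAt.eventually_lt continuousAt_const ?_)
    rw [hqx]
    have : 0 < η * r ^ 2 := by positivity
    linarith
  obtain ⟨z₀, hz₀, hqz₀, hz₀r, hz₀K⟩ := (hfreq.and_eventually (hqev.and
    ((eventually_nhdsWithin_of_eventually_nhds (Metric.ball_mem_nhds x hr)).and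
      self_mem_nhdsWithin))).exists
  obtain ⟨v, hv, hvz₀⟩ := hHV z₀ hz₀K _ hz₀
  have hsubX : Metric.closedBall x r ⊆ X := fun z hz => (hball hz).2
  obtain ⟨z₁, hz₁, hmax₁⟩ := ((((hV v hv).1.mono (hsubX.trans hXK)).add
    ((hqc.neg.upperSemicontinuous).upperSemicontinuousOn _))).exists_isMaxOn
    ⟨x, Metric.mem_closedBall_self hr.le⟩ (isCompact_closedBall x r)
  have h1 : v z₀ + -q z₀ ≤ v z₁ + -q z₁ := hmax₁ (Metric.ball_subset_closedBall hz₀r)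
  have h2 : uscEnvelope K H z₁ - quadFn a A z₁ ≤ uscEnvelope K H x - quadFn a A x :=
    (hball hz₁).1
  have hz₁K := hXK (hsubX hz₁)
  have h3 := (hVH v hv z₁ hz₁K).trans (le_uscEnvelope hz₁K hM)
  have h4 : η * ‖z₁ - x‖ ^ 2 < η * r ^ 2 := by
    simp only [hq] at h1 hqz₀
    have : 0 < η * r ^ 2 := by positivity
    linarith
  have h5 : ‖z₁ - x‖ < r := lt_of_pow_lt_pow_left₀ 2 hr.le (lt_of_mul_lt_mul_left h4 hηpos.le)
  have h6 : z₁ ∈ Metric.ball x r := by rwa [Metric.mem_ball, dist_eq_norm]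
  rw [hζη]
  refine (hV v hv).2 z₁ (hsubX hz₁) (a - (2 * η) • x) _ ?_
  filter_upwards [Metric.isOpen_ball.mem_nhds h6] with z hz
  have h7 : v z + -q z ≤ v z₁ + -q z₁ := hmax₁ (Metric.ball_subset_closedBall hz)
  have e1 := quadFn_add_sq a A η x z
  have e2 := quadFn_add_sq a A η x z₁
  simp only [hq] at h7
  linarith

/-- The competitors in Perron's method with lower obstacle `w` and boundary majorant `U`. -/
def perronFamily (S : Set (SymMat n)) (X K : Set (EucSp n)) (w U : EucSp n → ℝ) :
    Set (EucSp n → ℝ) :=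
  {v | UpperSemicontinuousOn v K ∧ QuadSub S X v ∧ (∀ z ∈ K, w z ≤ v z) ∧
    ∀ z ∈ K \ X, v z ≤ U z}

/-- The Perron function. -/
def perronSup (S : Set (SymMat n)) (X K : Set (EucSp n)) (w U : EucSp n → ℝ) (z : EucSp n) : ℝ :=
  sSup ((fun v : EucSp n → ℝ => v z) '' perronFamily S X K w U)

/-- A maximal element of the Perron family has a dual-subharmonic lower envelope. -/
lemma quadSub_dualSet_uscEnvelope_neg {S : Set (SymMat n)} (hS : IsSubeq S) {X K : Set (EucSp n)}
    (hX : IsOpen X) (hXK : X ⊆ K) {w U H : EucSp n → ℝ} {M : ℝ} (hM : ∀ z ∈ K, -H z ≤ M)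
    (hH : H ∈ perronFamily S X K w U)
    (hmax : ∀ v ∈ perronFamily S X K w U, ∀ z ∈ K, v z ≤ H z) :
    QuadSub (dualSet S) X (uscEnvelope K fun z => -H z) := by
  intro x hx a A hloc hA
  set G := uscEnvelope K fun z => -H z with hG
  obtain ⟨η, hη, hB⟩ := IsSubeq.exists_sub_mem hA
  obtain ⟨r, hr, hball⟩ := Metric.nhds_basis_ball.mem_iff.1 (inter_mem hloc (hX.mem_nhds hx))
  set b : EucSp n := -a - (2 * (-η / 2)) • x with hb
  have hB' : -A + (2 * (-η / 2)) • (1 : SymMat n) ∈ S := by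
    have : (2 * (-η / 2)) = -η := by ring
    rw [this, neg_smul, ← sub_eq_add_neg]
    exact hB
  set B := -A + (2 * (-η / 2)) • (1 : SymMat n) with hBdef
  have hq : ∀ z, quadFn b B z = -quadFn a A z - η / 2 * ‖z - x‖ ^ 2 + η / 2 * ‖x‖ ^ 2 := by
    intro z
    have := quadFn_add_sq (-a) (-A) (-η / 2) x z
    rw [quadFn_neg] at this
    linarith
  set κ := η * r ^ 2 / 8 with hκ
  have hκpos : 0 < κ := by positivity
  set C := quadFn a A x - G x - η / 2 * ‖x‖ ^ 2 + κ with hC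
  set g : EucSp n → ℝ := fun z => quadFn b B z + C with hg
  have hgc : Continuous g := (continuous_quadFn b B).add continuous_const
  have hgx : g x = -G x + κ := by
    simp only [hg, hq, hC, sub_self, norm_zero]; ring
  have hHG : ∀ z ∈ K, -H z ≤ G z := fun z hz => le_uscEnvelope (f := fun z => -H z) hz hM
  have hgH : ∀ z ∈ K, z ∈ Metric.ball x r → z ∉ Metric.closedBall x (r / 2) → g z ≤ H z := by
    intro z hzK hz hz'
    have h1 : G z - quadFn a A z ≤ G x - quadFn a A x := (hball hz).1
    have h2 := hHG z hzK
    rw [Metric.mem_closedBall, dist_eq_norm, not_le] at hz'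
    have h3 : (r / 2) ^ 2 ≤ ‖z - x‖ ^ 2 := by gcongr
    have h4 : η / 2 * (r / 2) ^ 2 ≤ η / 2 * ‖z - x‖ ^ 2 := by gcongr
    simp only [hg, hq, hC]
    linarith
  have hv : spliceMax (Metric.ball x r) H g ∈ perronFamily S X K w U := by
    refine ⟨upperSemicontinuousOn_spliceMax Metric.isOpen_ball Metric.isClosed_closedBall
      (Metric.closedBall_subset_ball (half_lt_self hr)) hH.1 hgc hgH,
      hH.2.1.spliceMax Metric.isOpen_ball ((quadSub_quadFn hS _ b hB').add_const C),
      fun z hz => (hH.2.2.1 z hz).trans (le_spliceMax _ _ _ z), fun z hz => ?_⟩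
    have : z ∉ Metric.ball x r := fun h => hz.2 (hball h).2
    simp only [spliceMax, this, if_false]
    exact hH.2.2.2 z hz
  have hfin : G x ≤ G x - κ / 2 := by
    refine uscEnvelope_le (hXK hx) ?_
    have h1 : ∀ᶠ z in 𝓝 x, -G x + κ / 2 < g z :=
      continuousAt_const.eventually_lt hgc.continuousAt (by rw [hgx]; linarith)
    filter_upwards [nhdsWithin_le_nhds h1, nhdsWithin_le_nhds (Metric.ball_mem_nhds x hr),
      self_mem_nhdsWithin] with z h2 h3 h4
    have h5 := hmax _ hv z h4
    simp only [spliceMax, h3, if_true] at h5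
    linarith [le_max_right (H z) (g z)]
  linarith

/-- Perron's method: existence between a continuous subharmonic and a continuous
superharmonic function, given lower barriers at every point of `K \ X`. -/
theorem exists_perron_solution {S : Set (SymMat n)} (hS : IsSubeq S) {X K : Set (EucSp n)}
    (hK : IsCompact K) (hX : IsOpen X) (hXK : X ⊆ K) {w U : EucSp n → ℝ}
    (hwc : ContinuousOn w K) (hUc : ContinuousOn U K) (hw : QuadSub S X w)
    (hU : QuadSub (dualSet S) X fun z => -U z) (hwU : ∀ z ∈ K \ X, w z ≤ U z)
    (hbar : ∀ y ∈ K \ X, ∀ δ > (0 : ℝ), ∃ v ∈ perronFamily S X K w U,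
      ∀ᶠ z in 𝓝[K] y, U y - δ < v z) :
    ∃ H : EucSp n → ℝ, ContinuousOn H K ∧ QuadSub S X H ∧
      QuadSub (dualSet S) X (fun z => -H z) ∧ (∀ z ∈ K, w z ≤ H z) ∧ (∀ z ∈ K, H z ≤ U z) ∧
      ∀ z ∈ K \ X, H z = U z := by
  set V := perronFamily S X K w U with hV
  set H := perronSup S X K w U with hHdef
  have hwV : w ∈ V := ⟨hwc.upperSemicontinuousOn, hw, fun _ _ => le_rfl, hwU⟩
  have hVU : ∀ v ∈ V, ∀ z ∈ K, v z ≤ U z := by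
    intro v hv z hz
    have := QuadSub.comparison hS hK hX hXK hv.1 hUc.neg.upperSemicontinuousOn hv.2.1 hU
      (fun y hy => by have := hv.2.2.2 y hy; simp only [Pi.neg_apply]; linarith) z hz
    simp only [Pi.neg_apply] at this
    linarith
  have hne : ∀ z, ((fun v : EucSp n → ℝ => v z) '' V).Nonempty := fun z => ⟨_, w, hwV, rfl⟩
  have hbdd : ∀ z ∈ K, BddAbove ((fun v : EucSp n → ℝ => v z) '' V) := fun z hz =>
    ⟨U z, by rintro _ ⟨v, hv, rfl⟩; exact hVU v hv z hz⟩
  have hVH : ∀ v ∈ V, ∀ z ∈ K, v z ≤ H z := fun v hv z hz => le_csSup (hbdd z hz) ⟨v, hv, rfl⟩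
  have hHU : ∀ z ∈ K, H z ≤ U z := fun z hz =>
    csSup_le (hne z) (by rintro _ ⟨v, hv, rfl⟩; exact hVU v hv z hz)
  have hHV : ∀ z ∈ K, ∀ c < H z, ∃ v ∈ V, c < v z := by
    intro z _ c hc
    obtain ⟨_, ⟨v, hv, rfl⟩, hcv⟩ := exists_lt_of_lt_csSup (hne z) hc
    exact ⟨v, hv, hcv⟩
  obtain ⟨M, hM⟩ := hUc.upperSemicontinuousOn.bddAbove_of_isCompact hK
  have hHM : ∀ z ∈ K, H z ≤ M := fun z hz => (hHU z hz).trans (hM ⟨z, hz, rfl⟩)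
  obtain ⟨M', hM'⟩ := hwc.neg.upperSemicontinuousOn.bddAbove_of_isCompact hK
  have hHM' : ∀ z ∈ K, -H z ≤ M' := fun z hz =>
    (neg_le_neg (hVH w hwV z hz)).trans (hM' ⟨z, hz, rfl⟩)
  have henvU : ∀ z ∈ K, uscEnvelope K H z ≤ U z := by
    intro z hz
    refine le_of_forall_pos_le_add fun ε hε => uscEnvelope_le hz ?_
    filter_upwards [(hUc z hz).eventually_lt continuousWithinAt_const
      (show U z < U z + ε by linarith), self_mem_nhdsWithin] with y hy hyK
    exact (hHU y hyK).trans hy.le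
  have henvV : uscEnvelope K H ∈ V :=
    ⟨upperSemicontinuousOn_uscEnvelope hHM,
      quadSub_uscEnvelope hS hX hXK (fun v hv => ⟨hv.1, hv.2.1⟩) hHM hVH hHV,
      fun z hz => (hVH w hwV z hz).trans (le_uscEnvelope hz hHM), fun z hz => henvU z hz.1⟩
  have hHeq : ∀ z ∈ K, uscEnvelope K H z = H z := fun z hz =>
    le_antisymm (hVH _ henvV z hz) (le_uscEnvelope hz hHM)
  have hHusc : UpperSemicontinuousOn H K := by
    intro x hx y hy
    filter_upwards [henvV.1 x hx y (by change uscEnvelope K H x < y; rwa [hHeq x hx]), self_mem_nhdsWithin] with z hz hzK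
    rwa [← hHeq z hzK]
  have hHsub : QuadSub S X H := henvV.2.1.congr hX fun x hx => hHeq x (hXK hx)
  have hHmem : H ∈ V := ⟨hHusc, hHsub, hVH w hwV, fun z hz => hHU z hz.1⟩
  set G := uscEnvelope K fun z => -H z with hG
  have hGsub : QuadSub (dualSet S) X G :=
    quadSub_dualSet_uscEnvelope_neg hS hX hXK hHM' hHmem hVH
  have hGusc : UpperSemicontinuousOn G K :=
    upperSemicontinuousOn_uscEnvelope (f := fun z => -H z) hHM'
  have hGU : ∀ y ∈ K \ X, G y ≤ -U y := by
    intro y hy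
    refine le_of_forall_pos_le_add fun δ hδ => uscEnvelope_le hy.1 ?_
    obtain ⟨v, hv, hvy⟩ := hbar y hy δ hδ
    filter_upwards [hvy, self_mem_nhdsWithin] with z hz hzK
    linarith [hVH v hv z hzK]
  have hGbd : ∀ y ∈ K \ X, H y + G y ≤ 0 := fun y hy => by linarith [hHU y hy.1, hGU y hy]
  have hGH : ∀ z ∈ K, G z = -H z := fun z hz =>
    le_antisymm (by linarith [QuadSub.comparison hS hK hX hXK hHusc hGusc hHsub hGsub hGbd z hz])
      (le_uscEnvelope (f := fun z => -H z) hz hHM')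
  refine ⟨H, ?_, hHsub, hGsub.congr hX fun x hx => hGH x (hXK hx), hVH w hwV, hHU,
    fun z hz => le_antisymm (hHU z hz.1) (by linarith [hGU z hz, hGH z hz.1])⟩
  refine continuousOn_iff_lower_upperSemicontinuousOn.2 ⟨fun x hx y hy => ?_, hHusc⟩
  filter_upwards [hGusc x hx (-y) (by change G x < -y; rw [hGH x hx]; exact neg_lt_neg hy), self_mem_nhdsWithin]
    with z hz hzK
  rw [hGH z hzK] at hz
  exact neg_lt_neg_iff.1 hz

lemma toEuclideanCLM_projMat (e v : EucSp n) :
    Matrix.toEuclideanCLM (n := Fin n) (𝕜 := ℝ) (projMat e) v = (inner ℝ e v : ℝ) • e := by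
  ext i
  simp [projMat, Matrix.mulVec, dotProduct, PiLp.inner_apply, Finset.sum_mul]
  refine Finset.sum_congr rfl fun j _ => by ring

lemma symForm_symProj (e v : EucSp n) : symForm (symProj e) v v = (inner ℝ e v : ℝ) ^ 2 := by
  have : symMap (symProj e) v = (inner ℝ e v : ℝ) • e := toEuclideanCLM_projMat e v
  rw [symForm, this, real_inner_smul_right, real_inner_comm]
  ring

lemma symForm_secondFF {ρ : EucSp n → ℝ} {y : EucSp n} {R A : SymMat n} {t : ℝ}
    (hR : (R : Matrix (Fin n) (Fin n) ℝ) = hessMatrix ρ y)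
    (hA : (A : Matrix (Fin n) (Fin n) ℝ) = secondFF ρ y + t • projMat (innerNormal ρ y))
    (v : EucSp n) :
    symForm A v v = ‖gradient ρ y‖⁻¹ *
      symForm R (v - (inner ℝ (innerNormal ρ y) v : ℝ) • innerNormal ρ y)
        (v - (inner ℝ (innerNormal ρ y) v : ℝ) • innerNormal ρ y) +
      t * (inner ℝ (innerNormal ρ y) v : ℝ) ^ 2 := by
  set e := innerNormal ρ y with he
  have h1 : symMap A v = ‖gradient ρ y‖⁻¹ •
      (symMap R (v - (inner ℝ e v : ℝ) • e) -
        (inner ℝ e (symMap R (v - (inner ℝ e v : ℝ) • e)) : ℝ) • e) +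
      t • (inner ℝ e v : ℝ) • e := by
    have hM : ∀ w, Matrix.toEuclideanCLM (n := Fin n) (𝕜 := ℝ) (1 - projMat e) w =
        w - (inner ℝ e w : ℝ) • e := by
      intro w
      rw [map_sub, map_one, sub_apply, toEuclideanCLM_projMat]
      rfl
    have hmul : ∀ (f g : EucSp n →L[ℝ] EucSp n) w, (f * g) w = f (g w) := fun _ _ _ => rfl
    rw [symMap, hA, secondFF, ← hR, map_add, map_smul, map_smul, map_mul, map_mul]
    simp only [add_apply, smul_apply, hmul, toEuclideanCLM_projMat]
    rw [← he]
    simp only [hM]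
    rfl
  rw [symForm, h1, symForm, inner_add_right, real_inner_smul_right, inner_sub_right,
    real_inner_smul_right, real_inner_smul_right, real_inner_smul_right, inner_sub_left,
    real_inner_smul_left, real_inner_comm e v]
  ring

/-- Strict convexity at a boundary point makes the Hessian of the defining function admissible
after a large correction in the normal direction. -/
lemma exists_corrected_hessian_mem (F : ConeSubequation n) {ρ : EucSp n → ℝ} {y : EucSp n}
    (hg : gradient ρ y ≠ 0) {R : SymMat n}
    (hR : (R : Matrix (Fin n) (Fin n) ℝ) = hessMatrix ρ y) {t : ℝ}
    (hA : secondFF ρ y + t • projMat (innerNormal ρ y) ∈ Subtype.val '' interior F.carrier) :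
    ∃ η > (0 : ℝ), ∃ κ ≥ (0 : ℝ),
      R + κ • symProj (innerNormal ρ y) - η • (1 : SymMat n) ∈ F.carrier := by
  obtain ⟨A, hAint, hAeq⟩ := hA
  obtain ⟨η, hη, hmem⟩ := IsSubeq.exists_sub_mem hAint
  set e := innerNormal ρ y with he
  set G := ‖gradient ρ y‖ with hG
  have hGpos : 0 < G := norm_pos_iff.2 hg
  have hnorm : ‖e‖ = 1 := by
    rw [he, innerNormal, norm_neg, norm_smul, norm_inv, norm_norm, inv_mul_cancel₀ hGpos.ne']
  have hee : (inner ℝ e e : ℝ) = 1 := by rw [real_inner_self_eq_norm_sq, hnorm]; norm_num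
  set N := ‖symMap R‖ with hN
  have hN0 : 0 ≤ N := norm_nonneg _
  have hGη : 0 < G * η := mul_pos hGpos hη
  refine ⟨G * η / 2, by positivity, N + G * |t| + 2 * N ^ 2 / (G * η), by positivity,
    F.isSubeq.mono _ (F.f2 _ hmem G hGpos) _ fun v => ?_⟩
  set s : ℝ := inner ℝ e v with hs
  set T := v - s • e with hT
  have hv : v = T + s • e := by rw [hT]; abel
  have heT : (inner ℝ e T : ℝ) = 0 := by
    rw [hT, inner_sub_right, real_inner_smul_right, hee, ← hs]; ring
  have hTe : (inner ℝ T e : ℝ) = 0 := by rw [real_inner_comm]; exact heT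
  have hvn : ‖v‖ ^ 2 = ‖T‖ ^ 2 + s ^ 2 := by
    rw [← real_inner_self_eq_norm_sq, ← real_inner_self_eq_norm_sq, hv, inner_add_left,
      inner_add_right, inner_add_right, real_inner_smul_left, real_inner_smul_left,
      real_inner_smul_right, real_inner_smul_right, hee, heT, hTe]
    ring
  have hRv : symForm R v v = symForm R T T + 2 * s * symForm R T e + s ^ 2 * symForm R e e := by
    rw [hv, symForm_add_left, symForm_add_right, symForm_add_right, symForm_smul_left,
      symForm_smul_right, symForm_smul_left, symForm_smul_right, symForm_comm R e T]
    ring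
  have hAv : G * symForm A v v = symForm R T T + G * t * s ^ 2 := by
    rw [symForm_secondFF hR hAeq v, ← he, ← hs, ← hT, ← hG, mul_add, mul_inv_cancel_left₀ hGpos.ne']
    ring
  rw [symForm_smul, symForm_sub, symForm_sub, symForm_add, symForm_smul, symForm_smul, symForm_smul,
    symForm_one, real_inner_self_eq_norm_sq, symForm_symProj, ← hs, mul_sub, hAv, hRv, hvn]
  have h1 : |symForm R T e| ≤ N * ‖T‖ := by simpa [hnorm] using abs_symForm_le R T e
  have h2 : |symForm R e e| ≤ N := by simpa [hnorm] using abs_symForm_le R e e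
  have h3 : -(N * s ^ 2) ≤ s ^ 2 * symForm R e e := by
    nlinarith [(abs_le.1 h2).1, sq_nonneg s]
  have h4 : -(G * η / 2 * ‖T‖ ^ 2 + 2 * N ^ 2 / (G * η) * s ^ 2) ≤ 2 * s * symForm R T e := by
    have h5 : |2 * s * symForm R T e| ≤ 2 * |s| * (N * ‖T‖) := by
      rw [abs_mul, abs_mul, abs_two]; gcongr
    have h6 : 2 * |s| * (N * ‖T‖) ≤ G * η / 2 * ‖T‖ ^ 2 + 2 * N ^ 2 / (G * η) * s ^ 2 := by
      rw [← sub_nonneg, ← sq_abs s]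
      have : G * η / 2 * ‖T‖ ^ 2 + 2 * N ^ 2 / (G * η) * |s| ^ 2 - 2 * |s| * (N * ‖T‖) =
          (G * η * ‖T‖ - 2 * N * |s|) ^ 2 / (2 * (G * η)) := by
        field_simp; ring
      rw [this]; positivity
    linarith [(abs_le.1 h5).1]
  have h7 : G * t * s ^ 2 ≤ G * |t| * s ^ 2 := by gcongr; exact le_abs_self t
  have h8 : 0 ≤ G * η * s ^ 2 := by positivity
  linarith

/-- A quadratic subharmonic function peaking at a strictly convex boundary point. -/
lemma exists_quadratic_barrier (F : ConeSubequation n) {ρ : EucSp n → ℝ} {y : EucSp n}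
    (hρ : ContDiffAt ℝ 2 ρ y) (hy : ρ y = 0) (hg : gradient ρ y ≠ 0) {t : ℝ}
    (hA : secondFF ρ y + t • projMat (innerNormal ρ y) ∈ Subtype.val '' interior F.carrier) :
    ∃ (b : EucSp n) (B : SymMat n), B ∈ F.carrier ∧ ∃ ε > (0 : ℝ),
      ∀ᶠ z in 𝓝 y, ρ z ≤ 0 → quadFn b B z - quadFn b B y ≤ -(ε * ‖z - y‖ ^ 2) := by
  obtain ⟨R, hR, hT⟩ := taylor_two_of_contDiffAt hρ
  obtain ⟨η, hη, κ, hκ, hB⟩ := exists_corrected_hessian_mem F hg hR hA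
  set e := innerNormal ρ y with he
  set B := R + κ • symProj e - η • (1 : SymMat n) with hBdef
  set g := gradient ρ y with hgdef
  have hGpos : 0 < ‖g‖ := norm_pos_iff.2 hg
  refine ⟨g - symMap B y, B, hB, η / 4, by positivity, ?_⟩
  set K := κ / (2 * ‖g‖ ^ 2) with hK
  have hK0 : 0 ≤ K := by positivity
  set N := ‖symMap R‖ with hN
  have hN0 : 0 ≤ N := norm_nonneg _
  set C := N / 2 + η / 8 with hC
  have hC0 : 0 ≤ C := by positivity
  have hev1 : ∀ᶠ z in 𝓝 y, -1 < 2 * K * ρ z := by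
    have hc : ContinuousAt (fun z => 2 * K * ρ z) y := continuousAt_const.mul hρ.continuousAt
    exact continuousAt_const.eventually_lt hc (by rw [hy]; norm_num)
  have hev2 : ∀ᶠ z in 𝓝 y, 2 * K * C ^ 2 * ‖z - y‖ ^ 2 < η / 8 := by
    have hc : ContinuousAt (fun z => 2 * K * C ^ 2 * ‖z - y‖ ^ 2) y := by fun_prop
    exact hc.eventually_lt continuousAt_const (by simp; positivity)
  filter_upwards [hT (η / 8) (by positivity), hev1, hev2] with z h1 h2 h3 hz
  rw [quadFn_centered, add_assoc, add_sub_cancel_left]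
  set d := z - y with hd
  rw [hy, zero_add] at h1
  set p : ℝ := inner ℝ g d with hp
  have hed : κ * (inner ℝ e d : ℝ) ^ 2 = 2 * K * p ^ 2 := by
    rw [he, innerNormal, inner_neg_left, real_inner_smul_left, ← hgdef, ← hp, hK]
    field_simp
  have hBd : symForm B d d = symForm R d d + 2 * K * p ^ 2 - η * ‖d‖ ^ 2 := by
    rw [hBdef, symForm_sub, symForm_add, symForm_smul, symForm_smul, symForm_one,
      real_inner_self_eq_norm_sq, symForm_symProj, hed]
  rw [hBd]
  obtain ⟨h4, h5⟩ := abs_le.1 h1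
  have hRd : |symForm R d d| ≤ N * ‖d‖ * ‖d‖ := abs_symForm_le R d d
  obtain ⟨h6, h7⟩ := abs_le.1 hRd
  have he1 : |ρ z - p| ≤ C * ‖d‖ ^ 2 := by
    rw [abs_le, hC]; constructor <;> linarith
  have he2 : (ρ z - p) ^ 2 ≤ (C * ‖d‖ ^ 2) ^ 2 := by
    rw [← sq_abs]; gcongr
  have he3 : p ^ 2 ≤ 2 * ρ z ^ 2 + 2 * (C * ‖d‖ ^ 2) ^ 2 := by
    nlinarith [sq_nonneg (2 * ρ z - p)]
  have he4 : K * p ^ 2 ≤ K * (2 * ρ z ^ 2 + 2 * (C * ‖d‖ ^ 2) ^ 2) := by gcongr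
  have he5 : 2 * K * C ^ 2 * ‖d‖ ^ 2 * ‖d‖ ^ 2 ≤ η / 8 * ‖d‖ ^ 2 := by gcongr
  have he6 : ρ z + 2 * K * ρ z ^ 2 ≤ 0 := by
    have : ρ z * (1 + 2 * K * ρ z) ≤ 0 := mul_nonpos_of_nonpos_of_nonneg hz (by linarith)
    linarith
  linarith

/-- A quadratic barrier can be glued to the obstacle to give a competitor with boundary value
close to `U y`. -/
lemma exists_mem_perronFamily_of_barrier {S : Set (SymMat n)} (hS : IsSubeq S)
    (hS2 : ∀ A ∈ S, ∀ t : ℝ, 0 < t → t • A ∈ S) {X K : Set (EucSp n)} (hK : IsCompact K)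
    {w U : EucSp n → ℝ} (hwc : ContinuousOn w K) (hUc : ContinuousOn U K) (hw : QuadSub S X w)
    (hwU : ∀ z ∈ K \ X, w z ≤ U z) {y : EucSp n} (hy : y ∈ K) {b : EucSp n} {B : SymMat n}
    (hB : B ∈ S) {ε : ℝ} (hε : 0 < ε)
    (hq : ∀ᶠ z in 𝓝[K] y, quadFn b B z - quadFn b B y ≤ -(ε * ‖z - y‖ ^ 2))
    {δ : ℝ} (hδ : 0 < δ) :
    ∃ v ∈ perronFamily S X K w U, ∀ᶠ z in 𝓝[K] y, U y - δ < v z := by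
  obtain ⟨M, hM⟩ := hwc.neg.upperSemicontinuousOn.bddAbove_of_isCompact hK
  have hM' : ∀ z ∈ K, -M ≤ w z := fun z hz => by
    have : -w z ≤ M := hM ⟨z, hz, rfl⟩
    linarith
  have hUev : ∀ᶠ z in 𝓝[K] y, U y - δ / 2 < U z :=
    continuousWithinAt_const.eventually_lt (hUc y hy) (by linarith)
  obtain ⟨r, hr, hball⟩ := Metric.mem_nhdsWithin_iff.1 (hq.and hUev)
  set C := (|U y| + |M|) * 4 / (ε * r ^ 2) + 1 with hC
  have hCpos : 0 < C := by positivity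
  have hCge : |U y| + |M| ≤ C * (ε * (r / 2) ^ 2) := by
    have : (|U y| + |M|) * 4 / (ε * r ^ 2) * (ε * (r / 2) ^ 2) = |U y| + |M| := by
      field_simp
      norm_num
    rw [hC, add_mul, this, one_mul]
    have : 0 < ε * (r / 2) ^ 2 := by positivity
    linarith
  set g : EucSp n → ℝ := fun z => C * quadFn b B z + (U y - δ / 2 - C * quadFn b B y) with hgdef
  have hgc : Continuous g := by
    have := continuous_quadFn b B
    fun_prop
  have hgle : ∀ z ∈ K, z ∈ Metric.ball y r → g z ≤ U y - δ / 2 - C * (ε * ‖z - y‖ ^ 2) := by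
    intro z hzK hz
    have h1 : quadFn b B z - quadFn b B y ≤ -(ε * ‖z - y‖ ^ 2) := (hball ⟨hz, hzK⟩).1
    have := mul_le_mul_of_nonneg_left h1 hCpos.le
    simp only [hgdef]
    linarith
  refine ⟨spliceMax (Metric.ball y r) w g, ⟨?_, ?_, fun z _ => le_spliceMax _ _ _ z, ?_⟩, ?_⟩
  · refine upperSemicontinuousOn_spliceMax Metric.isOpen_ball Metric.isClosed_closedBall
      (Metric.closedBall_subset_ball (half_lt_self hr)) hwc.upperSemicontinuousOn hgc
      fun z hzK hz hz' => ?_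
    rw [Metric.mem_closedBall, dist_eq_norm, not_le] at hz'
    have h2 : C * (ε * (r / 2) ^ 2) ≤ C * (ε * ‖z - y‖ ^ 2) := by gcongr
    linarith [hgle z hzK hz, hM' z hzK, le_abs_self (U y), le_abs_self M]
  · exact hw.spliceMax Metric.isOpen_ball
      (((quadSub_quadFn hS _ b hB).const_mul hS2 hCpos).add_const _)
  · intro z hz
    by_cases hzb : z ∈ Metric.ball y r
    · simp only [spliceMax, hzb, if_true]
      refine max_le (hwU z hz) ?_
      have h1 : U y - δ / 2 < U z := (hball ⟨hzb, hz.1⟩).2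
      have h2 : 0 ≤ C * (ε * ‖z - y‖ ^ 2) := by positivity
      linarith [hgle z hz.1 hzb]
    · simp only [spliceMax, hzb, if_false]
      exact hwU z hz
  · have h1 : ∀ᶠ z in 𝓝 y, U y - δ < g z :=
      continuousAt_const.eventually_lt hgc.continuousAt (by simp only [hgdef]; linarith)
    filter_upwards [nhdsWithin_le_nhds h1, nhdsWithin_le_nhds (Metric.ball_mem_nhds y hr)]
      with z h2 h3
    simp only [spliceMax, h3, if_true]
    exact h2.trans_le (le_max_right _ _)

lemma FHarmonicOn.quadSub_dual {F : ConeSubequation n} {X : Set (EucSp n)} {u : EucSp n → ℝ}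
    (h : FHarmonicOn F X (fun y => (u y : EReal))) :
    QuadSub (dualSet F.carrier) X fun y => -u y := by
  refine FSubharmonicOn.quadSub ?_
  simpa only [EReal.coe_neg] using h.2

lemma fHarmonicOn_of_quadSub {F : ConeSubequation n} {X : Set (EucSp n)} (hX : IsOpen X)
    {u : EucSp n → ℝ} (hc : ContinuousOn u X) (h : QuadSub F.carrier X u)
    (h' : QuadSub (dualSet F.carrier) X fun y => -u y) :
    FHarmonicOn F X (fun y => (u y : EReal)) := by
  refine ⟨h.fSubharmonicOn F.isSubeq hX hc, ?_⟩
  have := h'.fSubharmonicOn F.isSubeq.dual hX hc.neg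
  simpa only [EReal.coe_neg] using this

/-- The quadratic barrier at a boundary point of a strictly convex domain. -/
lemma StrictlyConvexBoundary.exists_barrier {F : ConeSubequation n} {Ω : Set (EucSp n)}
    (hΩ : IsOpen Ω) (hb : StrictlyConvexBoundary F Ω) {y : EucSp n} (hy : y ∈ frontier Ω) :
    ∃ (b : EucSp n) (B : SymMat n), B ∈ F.carrier ∧ ∃ ε > (0 : ℝ),
      ∀ᶠ z in 𝓝[closure Ω] y, quadFn b B z - quadFn b B y ≤ -(ε * ‖z - y‖ ^ 2) := by
  obtain ⟨ρ, hρ, hΩρ, hfr⟩ := hb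
  obtain ⟨hg, t, ht⟩ := hfr y hy
  have hle : ∀ z ∈ closure Ω, ρ z ≤ 0 := fun z hz =>
    closure_minimal (fun x hx => by rw [hΩρ] at hx; exact le_of_lt (show ρ x < 0 from hx))
      (isClosed_le hρ.continuous continuous_const) hz
  rw [hΩ.frontier_eq] at hy
  have hy0 : ρ y = 0 := by
    refine le_antisymm (hle y hy.1) (not_lt.1 fun h => hy.2 ?_)
    rw [hΩρ]
    exact h
  obtain ⟨b, B, hB, ε, hε, hev⟩ := exists_quadratic_barrier F
    ((hρ.of_le (WithTop.coe_le_coe.2 le_top)).contDiffAt) hy0 hg (ht t le_rfl)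
  refine ⟨b, B, hB, ε, hε, ?_⟩
  filter_upwards [nhdsWithin_le_nhds hev, self_mem_nhdsWithin] with z hz hzK
  exact hz (hle z hzK)

/-- Theorem 7.1, the construction in the finite case: given the normalized
finite-type singularity h (hypothesis (H1)), the solution H⁰ of the standard Dirichlet
problem, t ≥ 0, and hypothesis (H2) that H⁰ + t·h is F-subharmonic, there is H^t ∈ C(Ω̄),
F-harmonic on Ω∖{x₀}, with boundary values φ, satisfying the two-sided bounds (4a), (4b)
with equality at x₀ (so H^t(x₀) = H⁰(x₀) − t). -/
theorem dirichlet_singularities_stmt12 {n : ℕ} (F : ConeSubequation n) (hF3 : CondF3 F)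
    (Ω : Set (EucSp n)) (hΩ : IsBoundedDomain Ω) (hbdry : StrictlyConvexBoundary F Ω)
    (φ : EucSp n → ℝ) (hφ : ContinuousOn φ (frontier Ω))
    (x₀ : EucSp n) (hx₀ : x₀ ∈ Ω)
    -- Hypothesis (H1), normalized:
    (h : EucSp n → ℝ) (hhc : ContinuousOn h (closure Ω))
    (hharm : FHarmonicOn F (Ω \ {x₀}) (fun y => (h y : EReal)))
    (hnotest : NoTestAt Ω (fun y => (h y : EReal)) x₀)
    (h0 : h x₀ = 0) (hpos : ∀ y ∈ closure Ω, y ≠ x₀ → 0 < h y)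
    (hsup : sSup (h '' frontier Ω) = 1)
    -- The solution of the standard Dirichlet problem:
    (H0 : EucSp n → ℝ) (hH0c : ContinuousOn H0 (closure Ω))
    (hH0harm : FHarmonicOn F Ω (fun y => (H0 y : EReal)))
    (hH0bd : ∀ y ∈ frontier Ω, H0 y = φ y)
    (t : ℝ) (ht : 0 ≤ t)
    -- Hypothesis (H2):
    (hH2 : FSubharmonicOn F.carrier Ω (fun y => ((H0 y + t * h y : ℝ) : EReal))) :
    ∃ Ht : EucSp n → ℝ,
      ContinuousOn Ht (closure Ω) ∧
      FHarmonicOn F (Ω \ {x₀}) (fun y => (Ht y : EReal)) ∧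
      (∀ y ∈ frontier Ω, Ht y = φ y) ∧
      ((∀ y ∈ closure Ω, H0 y + t * (h y - 1) ≤ Ht y) ∧ Ht x₀ = H0 x₀ - t) ∧
      ∃ lam : ℝ, 0 < lam ∧
        (∀ y ∈ closure Ω, Ht y ≤ lam * h y + H0 x₀ + t * (h y - 1)) ∧
        Ht x₀ = lam * h x₀ + H0 x₀ + t * (h x₀ - 1) := by
  set c := H0 x₀ - t with hc
  have hKc : IsCompact (closure Ω) := hΩ.2.2.isCompact_closure
  have hfrK : frontier Ω ⊆ closure Ω := frontier_subset_closure
  have hfrne : ∀ y ∈ frontier Ω, y ≠ x₀ := by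
    rintro y hy rfl
    rw [hΩ.1.frontier_eq] at hy
    exact hy.2 hx₀
  have hfrc : IsCompact (frontier Ω) := hKc.of_isClosed_subset isClosed_frontier hfrK
  have hh1 : ∀ y ∈ frontier Ω, h y ≤ 1 := fun y hy => by
    rw [← hsup]
    exact le_csSup (hfrc.bddAbove_image (hhc.mono hfrK)) ⟨y, hy, rfl⟩
  have hh0 : ∀ y ∈ closure Ω, 0 ≤ h y := fun y hy => by
    by_cases hyx : y = x₀
    · rw [hyx, h0]
    · exact (hpos y hy hyx).le
  obtain ⟨m, hm, hmh⟩ : ∃ m > (0 : ℝ), ∀ y ∈ frontier Ω, m ≤ h y := by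
    rcases (frontier Ω).eq_empty_or_nonempty with he | hne
    · exact ⟨1, one_pos, by simp [he]⟩
    · obtain ⟨y, hy, hmin⟩ := hfrc.exists_isMinOn hne (hhc.mono hfrK)
      exact ⟨h y, hpos y (hfrK hy) (hfrne y hy), fun z hz => hmin hz⟩
  obtain ⟨M, hM⟩ := hKc.bddAbove_image hH0c
  have hM' : ∀ y ∈ closure Ω, H0 y ≤ M := fun y hy => hM ⟨y, hy, rfl⟩
  set lam := (|M| + |c| + 1) / m with hlam
  have hlampos : 0 < lam := by positivity
  have hlt : 0 < lam + t := by linarith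
  have hlamH0 : ∀ y ∈ frontier Ω, H0 y ≤ (lam + t) * h y + c := by
    intro y hy
    have h1 : lam * m = |M| + |c| + 1 := by rw [hlam]; field_simp
    have h2 : lam * m ≤ lam * h y := by gcongr; exact hmh y hy
    have h3 : 0 ≤ t * h y := mul_nonneg ht (hh0 y (hfrK hy))
    linarith [hM' y (hfrK hy), le_abs_self M, neg_abs_le c]
  set w : EucSp n → ℝ := fun y => H0 y + t * (h y - 1) with hw
  set U : EucSp n → ℝ := fun y => min (H0 y) ((lam + t) * h y + c) with hU
  have hX : IsOpen (Ω \ {x₀}) := hΩ.1.sdiff isClosed_singleton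
  have hXK : Ω \ {x₀} ⊆ closure Ω := Set.sdiff_subset.trans subset_closure
  have hKX : ∀ y ∈ closure Ω \ (Ω \ {x₀}), y ∈ frontier Ω ∨ y = x₀ := by
    intro y hy
    by_cases hyx : y = x₀
    · exact Or.inr hyx
    · rw [hΩ.1.frontier_eq]
      exact Or.inl ⟨hy.1, fun hyΩ => hy.2 ⟨hyΩ, hyx⟩⟩
  have hfrX : ∀ y ∈ frontier Ω, y ∈ closure Ω \ (Ω \ {x₀}) := by
    intro y hy
    rw [hΩ.1.frontier_eq] at hy
    exact ⟨hy.1, fun h' => hy.2 h'.1⟩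
  have hx₀X : x₀ ∈ closure Ω \ (Ω \ {x₀}) := ⟨subset_closure hx₀, fun h' => h'.2 rfl⟩
  have hwx₀ : w x₀ = c := by simp only [hw, h0]; ring
  have hUx₀ : U x₀ = c := by
    simp only [hU, h0, mul_zero, zero_add]
    exact min_eq_right (by linarith)
  have hUfr : ∀ y ∈ frontier Ω, U y = H0 y := fun y hy => min_eq_left (hlamH0 y hy)
  have hwc : ContinuousOn w (closure Ω) := by fun_prop
  have hUc : ContinuousOn U (closure Ω) := by fun_prop
  have hwsub : QuadSub F.carrier (Ω \ {x₀}) w := by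
    refine ((hH2.quadSub.mono_set Set.sdiff_subset).add_const (-t)).congr hX fun y _ => ?_
    simp only [hw]; ring
  have hUsub : QuadSub (dualSet F.carrier) (Ω \ {x₀}) fun z => -U z := by
    have h1 := hH0harm.quadSub_dual.mono_set (Set.sdiff_subset (s := Ω) (t := {x₀}))
    have h2 := (hharm.quadSub_dual.const_mul
      (fun A hA s hs => dualSet_smul_mem F.f2 hA hs) hlt).add_const (-c)
    refine (h1.max h2).congr hX fun y _ => ?_
    simp only [hU]
    rw [← max_neg_neg]
    congr 1
    ring
  have hwU : ∀ z ∈ closure Ω \ (Ω \ {x₀}), w z ≤ U z := by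
    intro z hz
    rcases hKX z hz with hz' | rfl
    · rw [hUfr z hz']
      have : t * (h z - 1) ≤ 0 := mul_nonpos_of_nonneg_of_nonpos ht (by linarith [hh1 z hz'])
      simp only [hw]
      linarith
    · rw [hwx₀, hUx₀]
  obtain ⟨Ht, hHc, hHsub, hHdual, hwH, hHU, hHeq⟩ := exists_perron_solution F.isSubeq hKc hX hXK
    hwc hUc hwsub hUsub hwU (by
      intro y hy δ hδ
      rcases hKX y hy with hy' | rfl
      · obtain ⟨b, B, hB, ε, hε, hev⟩ := hbdry.exists_barrier hΩ.1 hy'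
        exact exists_mem_perronFamily_of_barrier F.isSubeq F.f2 hKc hwc hUc hwsub hwU hy.1 hB hε
          hev hδ
      · refine ⟨w, ⟨hwc.upperSemicontinuousOn, hwsub, fun _ _ => le_rfl, hwU⟩, ?_⟩
        exact continuousWithinAt_const.eventually_lt (hwc y hy.1) (by rw [hUx₀, hwx₀]; linarith))
  have hHx₀ : Ht x₀ = c := by rw [hHeq x₀ hx₀X, hUx₀]
  refine ⟨Ht, hHc, fHarmonicOn_of_quadSub hX (hHc.mono hXK) hHsub hHdual, fun y hy => ?_,
    ⟨hwH, hHx₀⟩, lam, hlampos, fun y hy => ?_, ?_⟩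
  · rw [hHeq y (hfrX y hy), hUfr y hy, hH0bd y hy]
  · have : Ht y ≤ (lam + t) * h y + c := (hHU y hy).trans (min_le_right _ _)
    linarith
  · rw [hHx₀, h0, hc]; ring
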